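/- Frequency-wise decomposition of the linearized Vlasov–Poisson density (Theorem 1.1 at a fixed low spatial frequency): There exist ν₀ > 0, λ₀ > 0, C > 0 and functions p : (0,ν₀) → ℂ and J : (0,ν₀) → ℂ satisfying, for every κ ∈ (0,ν₀), Re p(κ) < 0, |p(κ) − i·ω_p| ≤ C·κ² and |J(κ) − i·ω_p/2| ≤ C·κ², such that the following holds: for every κ ∈ (0,ν₀), every bounded continuous H : [0,∞) → ℂ, and every continuous ρ : [0,∞) → ℂ satisfying the Volterra equation ρ(t) = H(t) − w₀·n₀·∫₀ᵗ (t−τ)·exp(−β·κ²·(t−τ)²/2)·ρ(τ) dτ for all t ≥ 0, one has for all t ≥ 0 the estimate |ρ(t) − H(t) − ∫₀ᵗ 2·Re( J(κ)·exp(p(κ)·(t−τ)) )·H(τ) dτ| ≤ C·κ³·∫₀ᵗ exp(−λ₀·κ·(t−τ))·|H(τ)| dτ. -/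

import Mathlib

open MeasureTheory Complex

/-- integrand of the Gaussian moments -/
noncomputable def momI (β : ℝ) (n : ℕ) (z : ℂ) (s : ℝ) : ℂ :=
  (s : ℂ) ^ n * cexp (-z * s - β * s ^ 2 / 2)

/-- Gaussian half-line moments -/
noncomputable def mom (β : ℝ) (n : ℕ) (z : ℂ) : ℂ := ∫ s in Set.Ioi (0:ℝ), momI β n z s

lemma momI_norm (β : ℝ) (n : ℕ) (z : ℂ) (s : ℝ) (hs : 0 ≤ s) :
    ‖momI β n z s‖ = s ^ n * Real.exp (-z.re * s - β * s ^ 2 / 2) := by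
  unfold momI
  rw [norm_mul, norm_pow, Complex.norm_exp, Complex.norm_real, Real.norm_of_nonneg hs]
  congr 2
  have : (-z * s - β * s ^ 2 / 2 : ℂ) = -z * s - ((β * s ^ 2 / 2 : ℝ) : ℂ) := by push_cast; ring
  rw [this, Complex.sub_re, Complex.ofReal_re]
  simp

lemma momI_cont (β : ℝ) (n : ℕ) (z : ℂ) : Continuous (momI β n z) := by
  unfold momI; fun_prop

lemma gauss_int (β : ℝ) (hβ : 0 < β) (n : ℕ) (a : ℝ) :
    IntegrableOn (fun s : ℝ => s ^ n * Real.exp (-a * s - β * s ^ 2 / 2)) (Set.Ioi 0) := by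
  have h := (integrableOn_rpow_mul_exp_neg_mul_sq (b := β / 4) (by positivity)
    (s := (n:ℝ)) (by have : (0:ℝ) ≤ n := n.cast_nonneg
                     linarith)).const_mul (Real.exp (a ^ 2 / β))
  refine Integrable.mono' h (by
    apply Continuous.aestronglyMeasurable; fun_prop) ?_
  filter_upwards [ae_restrict_mem measurableSet_Ioi] with s hs
  have hs' : (0:ℝ) < s := hs
  rw [Real.norm_of_nonneg (by positivity), Real.rpow_natCast]
  have : Real.exp (-a * s - β * s ^ 2 / 2) ≤
      Real.exp (a ^ 2 / β) * Real.exp (-(β/4) * s ^ 2) := by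
    rw [← Real.exp_add]
    apply Real.exp_le_exp.mpr
    have h1 : 0 ≤ (a + β * s / 2) ^ 2 / β := by positivity
    have h2 : (a + β * s / 2) ^ 2 / β = a ^ 2 / β + a * s + β * s ^ 2 / 4 := by
      field_simp; ring
    linarith
  calc _ ≤ s ^ n * (Real.exp (a ^ 2 / β) * Real.exp (-(β/4) * s ^ 2)) := by gcongr
    _ = _ := by ring

lemma momI_integrable (β : ℝ) (hβ : 0 < β) (n : ℕ) (z : ℂ) :
    IntegrableOn (momI β n z) (Set.Ioi 0) := by
  refine Integrable.mono' (gauss_int β hβ n z.re) (momI_cont β n z).aestronglyMeasurable ?_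
  filter_upwards [ae_restrict_mem measurableSet_Ioi] with s hs
  exact (momI_norm β n z s (le_of_lt hs)).le

lemma mom_bound (β : ℝ) (hβ : 0 < β) (n : ℕ) :
    ∃ C > 0, ∀ z : ℂ, -1 ≤ z.re → ‖mom β n z‖ ≤ C := by
  refine ⟨(∫ s in Set.Ioi (0:ℝ), s ^ n * Real.exp (-(-1) * s - β * s ^ 2 / 2)) + 1, ?_, ?_⟩
  · have : 0 ≤ ∫ s in Set.Ioi (0:ℝ), s ^ n * Real.exp (-(-1) * s - β * s ^ 2 / 2) := by
      apply setIntegral_nonneg measurableSet_Ioi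
      intro s hs
      have hs' : (0:ℝ) < s := hs
      positivity
    linarith
  · intro z hz
    have : ‖mom β n z‖ ≤ ∫ s in Set.Ioi (0:ℝ), s ^ n * Real.exp (-(-1) * s - β * s ^ 2 / 2) := by
      refine norm_integral_le_of_norm_le (gauss_int β hβ n (-1)) ?_
      filter_upwards [ae_restrict_mem measurableSet_Ioi] with s hs
      have hs' : (0:ℝ) < s := hs
      rw [momI_norm β n z s hs'.le]
      gcongr
    linarith

lemma mom_hasDerivAt (β : ℝ) (hβ : 0 < β) (n : ℕ) (z : ℂ) :
    HasDerivAt (mom β n) (-mom β (n+1) z) z := by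
  have := (hasDerivAt_integral_of_dominated_loc_of_deriv_le
    (μ := volume.restrict (Set.Ioi (0:ℝ))) (𝕜 := ℂ)
    (F := fun z s => momI β n z s) (F' := fun z s => - momI β (n+1) z s) (x₀ := z)
    (s := Metric.ball z 1) (bound := fun s : ℝ => s ^ (n+1) * Real.exp (-(z.re - 1) * s - β * s ^ 2 / 2))
    (Metric.ball_mem_nhds z one_pos)
    (Filter.Eventually.of_forall fun w => (momI_cont β n w).aestronglyMeasurable)
    (momI_integrable β hβ n z)
    (momI_cont β (n+1) z).neg.aestronglyMeasurable ?_ (gauss_int β hβ (n+1) (z.re - 1)) ?_).2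
  · rw [integral_neg] at this
    exact this
  · filter_upwards [ae_restrict_mem measurableSet_Ioi] with s hs w hw
    have hs' : (0:ℝ) < s := hs
    rw [norm_neg, momI_norm β _ w s hs'.le]
    have h1 : z.re - 1 ≤ w.re := by
      have := Complex.abs_re_le_norm (w - z)
      rw [Metric.mem_ball, dist_eq_norm] at hw
      have := (abs_lt.mp (lt_of_le_of_lt this hw)).1
      simp at this; linarith
    gcongr
  · refine Filter.Eventually.of_forall fun s w _ => ?_
    unfold momI
    have h1 : HasDerivAt (fun w : ℂ => -w * (s:ℂ) - β * s ^ 2 / 2) (-(s:ℂ)) w := by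
      simpa using (((hasDerivAt_id w).neg).mul_const (s:ℂ)).sub_const ((β:ℂ) * s ^ 2 / 2)
    exact ((h1.cexp).const_mul ((s:ℂ)^n)).congr_deriv (by ring)

lemma momI_tendsto (β : ℝ) (hβ : 0 < β) (n : ℕ) (z : ℂ) :
    Filter.Tendsto (momI β n z) Filter.atTop (nhds 0) := by
  have h := Real.tendsto_pow_mul_exp_neg_atTop_nhds_zero n
  refine squeeze_zero_norm' ?_ h
  filter_upwards [Filter.eventually_ge_atTop (0:ℝ),
    Filter.eventually_ge_atTop (2 * (1 - z.re) / β)] with s hs hs2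
  rw [momI_norm β n z s hs]
  gcongr
  rw [div_le_iff₀ hβ] at hs2
  nlinarith

lemma mom_hasDeriv_s (β : ℝ) (n : ℕ) (z : ℂ) (s : ℝ) :
    HasDerivAt (momI β (n+1) z)
      (((n:ℂ)+1) * momI β n z s - z * momI β (n+1) z s - β * momI β (n+2) z s) s := by
  unfold momI
  have h0 : HasDerivAt (fun s : ℝ => (s:ℂ)) 1 s := Complex.ofRealCLM.hasDerivAt
  have h1 : HasDerivAt (fun s : ℝ => -z * (s:ℂ) - β * (s:ℂ) ^ 2 / 2) (-z - β * s) s := by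
    exact ((h0.const_mul (-z)).sub (((h0.pow 2).const_mul (β:ℂ)).div_const 2)).congr_deriv
      (by simp; ring)
  exact ((h0.pow (n+1)).mul h1.cexp).congr_deriv (by simp; ring)

lemma mom_hasDeriv_s0 (β : ℝ) (z : ℂ) (s : ℝ) :
    HasDerivAt (momI β 0 z) (- z * momI β 0 z s - β * momI β 1 z s) s := by
  unfold momI
  have h0 : HasDerivAt (fun s : ℝ => (s:ℂ)) 1 s := Complex.ofRealCLM.hasDerivAt
  have h1 : HasDerivAt (fun s : ℝ => -z * (s:ℂ) - β * (s:ℂ) ^ 2 / 2) (-z - β * s) s := by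
    exact ((h0.const_mul (-z)).sub (((h0.pow 2).const_mul (β:ℂ)).div_const 2)).congr_deriv
      (by simp; ring)
  simp only [pow_zero, one_mul]
  exact h1.cexp.congr_deriv (by ring)

lemma mom_rec (β : ℝ) (hβ : 0 < β) (n : ℕ) (z : ℂ) :
    z * mom β (n+1) z = ((n:ℂ)+1) * mom β n z - β * mom β (n+2) z := by
  have i0 := (momI_integrable β hβ n z).const_mul ((n:ℂ)+1)
  have i1 := (momI_integrable β hβ (n+1) z).const_mul z
  have i2 := (momI_integrable β hβ (n+2) z).const_mul (β:ℂ)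
  have := integral_Ioi_of_hasDerivAt_of_tendsto (a := 0)
    (momI_cont β (n+1) z).continuousWithinAt (fun s _ => mom_hasDeriv_s β n z s)
    ((i0.sub i1).sub i2) (momI_tendsto β hβ (n+1) z)
  have i01 : IntegrableOn (fun x => ((n:ℂ)+1) * momI β n z x - z * momI β (n+1) z x)
    (Set.Ioi 0) := i0.sub i1
  rw [integral_sub i01 i2, integral_sub i0 i1, integral_const_mul, integral_const_mul,
    integral_const_mul] at this
  have h0 : momI β (n+1) z 0 = 0 := by simp [momI]
  rw [h0] at this
  unfold mom
  linear_combination -this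

lemma mom_rec0 (β : ℝ) (hβ : 0 < β) (z : ℂ) :
    z * mom β 0 z = 1 - β * mom β 1 z := by
  have i1 := (momI_integrable β hβ 0 z).const_mul (-z)
  have i2 := (momI_integrable β hβ 1 z).const_mul (β:ℂ)
  have := integral_Ioi_of_hasDerivAt_of_tendsto (a := 0)
    (momI_cont β 0 z).continuousWithinAt (fun s _ => mom_hasDeriv_s0 β z s)
    (i1.sub i2) (momI_tendsto β hβ 0 z)
  rw [integral_sub i1 i2, integral_const_mul, integral_const_mul] at this
  have h0 : momI β 0 z 0 = 1 := by simp [momI]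
  rw [h0] at this
  unfold mom
  linear_combination -this

lemma mom_conj (β : ℝ) (n : ℕ) (z : ℂ) :
    mom β n (starRingEnd ℂ z) = starRingEnd ℂ (mom β n z) := by
  unfold mom
  rw [← integral_conj]
  congr 1
  ext s
  have h2 : (starRingEnd ℂ) 2 = 2 := Complex.conj_ofNat 2
  simp [momI, ← Complex.exp_conj, h2]

lemma mom_key (β : ℝ) (hβ : 0 < β) (z : ℂ) :
    1 - (z ^ 2 + 3 * β) * mom β 1 z = - β ^ 2 * mom β 3 z := by
  have h0 := mom_rec0 β hβ z
  have h1 := mom_rec β hβ 0 z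
  have h2 := mom_rec β hβ 1 z
  norm_num at h1 h2
  linear_combination (-1:ℂ) * h0 - z * h1 + (β:ℂ) * h2

open MeasureTheory Complex

lemma mom1_real_pos (β : ℝ) (hβ : 0 < β) (a : ℝ) : 0 < (mom β 1 (a:ℂ)).re := by
  have h : mom β 1 (a:ℂ) = ((∫ s in Set.Ioi (0:ℝ), s ^ 1 * Real.exp (-a * s - β * s ^ 2 / 2) : ℝ) : ℂ) := by
    unfold mom
    rw [← integral_complex_ofReal]
    congr 1; ext s
    simp [momI]
  rw [h, Complex.ofReal_re]
  have hnn : ∀ s ∈ Set.Ioi (0:ℝ), 0 < s ^ 1 * Real.exp (-a * s - β * s ^ 2 / 2) := by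
    intro s hs
    have : (0:ℝ) < s := hs
    positivity
  rw [setIntegral_pos_iff_support_of_nonneg_ae _ (gauss_int β hβ 1 a)]
  · have : Set.Ioi (0:ℝ) ⊆ (Function.support fun s : ℝ => s ^ 1 * Real.exp (-a * s - β * s ^ 2 / 2)) ∩ Set.Ioi 0 :=
      fun s hs => ⟨(hnn s hs).ne', hs⟩
    refine lt_of_lt_of_le ?_ (measure_mono this)
    simp
  · filter_upwards [ae_restrict_mem measurableSet_Ioi] with s hs
    exact (hnn s hs).le

lemma penrose_zero (β : ℝ) (hβ : 0 < β) (b : ℝ) : (mom β 0 (b * I)).re ≠ 0 := by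
  intro h
  have hsum : mom β 0 (b * I) + mom β 0 (starRingEnd ℂ (b * I)) = 0 := by
    rw [mom_conj, Complex.add_conj, h]; simp
  have hintg : Integrable (fun s : ℝ => momI β 0 (b * I) s) := by
    have := integrable_cexp_quadratic (b := (β/2 : ℂ)) (by
      have : ((β/2 : ℂ)).re = (β/2) := by
        norm_cast
      rw [this]; linarith) (-(b * I)) 0
    refine this.congr (Filter.Eventually.of_forall fun s => ?_)
    simp only [momI, pow_zero, one_mul]
    congr 1; ring
  have h2 : mom β 0 (starRingEnd ℂ (b * I)) = ∫ s in Set.Iic (0:ℝ), momI β 0 (b * I) s := by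
    unfold mom
    have := integral_comp_neg_Ioi (0:ℝ) (fun s => momI β 0 (b * I) s)
    rw [neg_zero] at this
    rw [← this]
    congr 1; ext s
    simp [momI]
  rw [h2, add_comm] at hsum
  unfold mom at hsum
  rw [intervalIntegral.integral_Iic_add_Ioi hintg.integrableOn hintg.integrableOn] at hsum
  have hg := fourierIntegral_gaussian (b := (β/2 : ℂ)) (by
      have : ((β/2 : ℂ)).re = (β/2) := by norm_cast
      rw [this]; linarith) (-(b:ℂ))
  have hg' : ∫ s : ℝ, momI β 0 (b * I) s = ∫ (x : ℝ), cexp (I * -(b:ℂ) * ↑x) * cexp (-(β/2 : ℂ) * ↑x ^ 2) := by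
    congr 1; ext s
    simp only [momI, pow_zero, one_mul, ← Complex.exp_add]
    congr 1; ring
  rw [hg', hg] at hsum
  have hβ' : (β:ℂ) ≠ 0 := by exact_mod_cast hβ.ne'
  have hpi : (Real.pi:ℂ) ≠ 0 := by exact_mod_cast Real.pi_ne_zero
  rcases mul_eq_zero.mp hsum with h3 | h3
  · rw [Complex.cpow_eq_zero_iff] at h3
    have := h3.1
    simp [hβ', hpi] at this
  · exact Complex.exp_ne_zero _ h3

lemma mom0_rep (β : ℝ) (hβ : 0 < β) (z : ℂ) (hz : 0 < z.re) :
    ∃ A : ℝ, (A : ℂ) * mom β 0 z = ∫ v : ℝ, ((Real.exp (-(1/(2*β)) * v ^ 2) : ℝ) : ℂ) / (z + I * v) := by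
  refine ⟨(Real.pi / (1/(2*β))) ^ (1/2 : ℝ), ?_⟩
  have hb : 0 < 1/(2*β) := by positivity
  have hF : ∀ s : ℝ, ∫ v : ℝ, cexp (-(z + I * v) * s) * ((Real.exp (-(1/(2*β)) * v ^ 2) : ℝ) : ℂ)
      = (((Real.pi / (1/(2*β))) ^ (1/2 : ℝ) : ℝ) : ℂ) * momI β 0 z s := by
    intro s
    have hg := fourierIntegral_gaussian (b := ((1/(2*β) : ℝ) : ℂ)) (by rw [Complex.ofReal_re]; exact hb) (-(s:ℂ))
    have h1 : ∀ v : ℝ, cexp (-(z + I * v) * s) * ((Real.exp (-(1/(2*β)) * v ^ 2) : ℝ) : ℂ) =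
        cexp (-z * s) * (cexp (I * -(s:ℂ) * v) * cexp (-((1/(2*β) : ℝ) : ℂ) * (v:ℂ) ^ 2)) := by
      intro v
      rw [Complex.ofReal_exp, ← Complex.exp_add, ← Complex.exp_add, ← Complex.exp_add]
      congr 1; push_cast; ring
    simp_rw [h1]
    rw [integral_const_mul, hg, Complex.ofReal_cpow (by positivity)]
    simp only [momI, pow_zero, one_mul]
    have h2 : cexp (-z * s - β * s ^ 2 / 2) = cexp (-z * s) * cexp (-(-(s:ℂ)) ^ 2 / (4 * ((1/(2*β) : ℝ) : ℂ))) := by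
      rw [← Complex.exp_add]
      congr 1
      have hβ' : (β:ℂ) ≠ 0 := by exact_mod_cast hβ.ne'
      push_cast
      field_simp
      ring
    rw [h2]
    push_cast
    ring
  have hL : ∀ v : ℝ, ∫ s in Set.Ioi (0:ℝ), cexp (-(z + I * v) * s) * ((Real.exp (-(1/(2*β)) * v ^ 2) : ℝ) : ℂ)
      = ((Real.exp (-(1/(2*β)) * v ^ 2) : ℝ) : ℂ) / (z + I * v) := by
    intro v
    rw [integral_mul_const, integral_exp_mul_complex_Ioi (by simp; exact hz)]
    rw [Complex.ofReal_zero, mul_zero, Complex.exp_zero, neg_div_neg_eq]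
    ring
  unfold mom
  rw [← integral_const_mul]
  simp_rw [← hF, ← hL]
  rw [integral_integral_swap]
  have hi : Integrable (fun p : ℝ × ℝ => Real.exp (-z.re * p.1) * Real.exp (-(1/(2*β)) * p.2 ^ 2))
      ((volume.restrict (Set.Ioi (0:ℝ))).prod volume) :=
    Integrable.mul_prod (f := fun s : ℝ => Real.exp (-z.re * s)) (g := fun v : ℝ => Real.exp (-(1/(2*β)) * v ^ 2))
      (integrableOn_exp_mul_Ioi (by linarith) 0) (integrable_exp_neg_mul_sq hb)
  refine hi.mono' ?_ (Filter.Eventually.of_forall fun p => ?_)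
  · apply Continuous.aestronglyMeasurable
    unfold Function.uncurry
    fun_prop
  · simp only [Function.uncurry]
    rw [norm_mul, Complex.norm_real, Real.norm_of_nonneg (Real.exp_pos _).le, Complex.norm_exp]
    simp

lemma penrose_im (β : ℝ) (hβ : 0 < β) (z : ℂ) (hz : 0 < z.re) (him : (z * mom β 0 z).im = 0) :
    z.im = 0 := by
  obtain ⟨A, hA⟩ := mom0_rep β hβ z hz
  set g : ℝ → ℝ := fun v => Real.exp (-(1/(2*β)) * v ^ 2) with hg
  have hb : 0 < 1/(2*β) := by positivity
  have hgpos : ∀ v, 0 < g v := fun v => Real.exp_pos _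
  have hne : ∀ v : ℝ, z + I * v ≠ 0 := by
    intro v h
    have := congrArg Complex.re h
    simp at this; linarith
  have hgi : Integrable g := integrable_exp_neg_mul_sq hb
  have hi0 : Integrable (fun v : ℝ => ((g v : ℝ) : ℂ) / (z + I * v)) := by
    refine (hgi.mul_const (z.re⁻¹)).mono' ?_ (Filter.Eventually.of_forall fun v => ?_)
    · apply Continuous.aestronglyMeasurable
      refine Continuous.div (by fun_prop) (by fun_prop) hne
    · rw [norm_div, Complex.norm_real, Real.norm_of_nonneg (hgpos v).le, div_eq_mul_inv]
      have h1 : z.re ≤ ‖z + I * v‖ := by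
        refine le_trans ?_ (Complex.re_le_norm _)
        simp
      have := hgpos v
      gcongr
  have hi1 : Integrable (fun v : ℝ => z * (((g v : ℝ) : ℂ) / (z + I * v))) := hi0.const_mul z
  set w : ℝ → ℝ := fun v => (z * (((g v : ℝ) : ℂ) / (z + I * v))).im with hw
  have hwint : Integrable w := hi1.im
  have hw0 : ∫ v, w v = 0 := by
    have : ∫ v, w v = (∫ v : ℝ, z * (((g v : ℝ) : ℂ) / (z + I * v))).im := integral_im hi1
    rw [this, integral_const_mul, ← hA]
    have : z * ((A:ℂ) * mom β 0 z) = (A:ℂ) * (z * mom β 0 z) := by ring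
    rw [this, Complex.im_ofReal_mul, him, mul_zero]
  have hw0' : ∫ v, w (-v) = 0 := by rw [integral_neg_eq_self w]; exact hw0
  have hsum : ∫ v, (w v + w (-v)) = 0 := by
    rw [integral_add hwint hwint.comp_neg, hw0, hw0']; simp
  have hform : ∀ v, w v + w (-v) = 4 * z.re * z.im * g v * v ^ 2 /
      ((z.re ^ 2 + (z.im + v) ^ 2) * (z.re ^ 2 + (z.im - v) ^ 2)) := by
    intro v
    have hwv : ∀ v, w v = - z.re * v * g v / (z.re ^ 2 + (z.im + v) ^ 2) := by
      intro v
      have hd : z.re ^ 2 + (z.im + v) ^ 2 ≠ 0 := by positivity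
      have : z * (((g v : ℝ) : ℂ) / (z + I * v)) = ((g v / (z.re ^ 2 + (z.im + v) ^ 2) : ℝ) : ℂ) *
          (z * (starRingEnd ℂ (z + I * v))) := by
        rw [div_eq_mul_inv, Complex.inv_def]
        have : Complex.normSq (z + I * v) = z.re ^ 2 + (z.im + v) ^ 2 := by
          rw [Complex.normSq_apply]; simp; ring
        rw [this]; push_cast; ring
      rw [hw]; simp only
      rw [this, Complex.im_ofReal_mul]
      simp
      ring
    have hge : g (-v) = g v := by simp [hg]
    rw [hwv, hwv, hge]
    have hd : z.re ^ 2 + (z.im + v) ^ 2 ≠ 0 := by positivity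
    have hd' : z.re ^ 2 + (z.im - v) ^ 2 ≠ 0 := by positivity
    have hd'' : z.re ^ 2 + (z.im + -v) ^ 2 ≠ 0 := by positivity
    field_simp
    ring
  by_contra hb0
  have hpos : ∫ v, z.im * (w v + w (-v)) = 0 := by rw [integral_const_mul, hsum, mul_zero]
  have hform2 : ∀ v, z.im * (w v + w (-v)) = 4 * z.re * z.im ^ 2 * g v * v ^ 2 /
      ((z.re ^ 2 + (z.im + v) ^ 2) * (z.re ^ 2 + (z.im - v) ^ 2)) := by
    intro v; rw [hform]; ring
  have hae := (integral_eq_zero_iff_of_nonneg (f := fun v => z.im * (w v + w (-v))) (fun v => by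
      simp only [Pi.zero_apply]
      rw [hform2]
      have := hgpos v
      positivity) ((hwint.add hwint.comp_neg).const_mul z.im)).mp hpos
  have hcont : Continuous fun v => z.im * (w v + w (-v)) := by
    simp_rw [hform2]
    refine Continuous.div (by fun_prop) (by fun_prop) (fun v => ?_)
    positivity
  have := congrFun ((Continuous.ae_eq_iff_eq volume hcont continuous_const).mp hae) 1
  rw [hform2] at this
  have h1 := hgpos 1
  have h2 : 0 < 4 * z.re * z.im ^ 2 * g 1 * 1 ^ 2 /
      ((z.re ^ 2 + (z.im + 1) ^ 2) * (z.re ^ 2 + (z.im - 1) ^ 2)) := by positivity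
  exact h2.ne' this

lemma penrose (β : ℝ) (hβ : 0 < β) (z : ℂ) (hz : 0 ≤ z.re) (c : ℝ) (hc : 0 ≤ c) :
    mom β 1 z ≠ -(c:ℂ) := by
  intro h
  have h0 := mom_rec0 β hβ z
  have h1 : z * mom β 0 z = ((1 + β * c : ℝ) : ℂ) := by rw [h0, h]; push_cast; ring
  have hpos : 0 < 1 + β * c := by positivity
  rcases hz.eq_or_lt with hz0 | hz0
  · have hzI : z = (z.im : ℂ) * I := by apply Complex.ext <;> simp [← hz0]
    have hre := penrose_zero β hβ z.im
    rw [← hzI] at hre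
    have hi := congrArg Complex.im h1
    have hr := congrArg Complex.re h1
    simp [← hz0] at hi hr
    rcases hi with hi | hi
    · rw [hi] at hr; simp at hr; linarith
    · exact hre hi
  · have him := penrose_im β hβ z hz0 (by rw [h1]; simp)
    have hzr : z = (z.re : ℂ) := by apply Complex.ext <;> simp [him]
    have := mom1_real_pos β hβ z.re
    rw [← hzr, h] at this
    simp at this
    linarith

open MeasureTheory Complex

/-- the remainder `1 / N z - z ^ 2 - 3 β` -/
noncomputable def qf (β : ℝ) (z : ℂ) : ℂ := -β ^ 2 * mom β 3 z / mom β 1 z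

lemma qf_eq (β : ℝ) (hβ : 0 < β) (z : ℂ) (h : mom β 1 z ≠ 0) :
    1 / mom β 1 z = z ^ 2 + 3 * β + qf β z := by
  unfold qf
  rw [← mom_key β hβ z]
  field_simp
  ring

lemma qf_conj (β : ℝ) (z : ℂ) : qf β (starRingEnd ℂ z) = starRingEnd ℂ (qf β z) := by
  simp [qf, mom_conj]

lemma mom_cont (β : ℝ) (hβ : 0 < β) (n : ℕ) : Continuous (mom β n) :=
  continuous_iff_continuousAt.mpr fun z => (mom_hasDerivAt β hβ n z).continuousAt

lemma qf_diff (β : ℝ) (hβ : 0 < β) (z : ℂ) (h : mom β 1 z ≠ 0) : DifferentiableAt ℂ (qf β) z := by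
  unfold qf
  exact ((mom_hasDerivAt β hβ 3 z).differentiableAt.const_mul _).div
    (mom_hasDerivAt β hβ 1 z).differentiableAt h

lemma mom_decay (β : ℝ) (hβ : 0 < β) : ∃ K ≥ (1:ℝ), ∀ z : ℂ, -1 ≤ z.re →
    ‖z‖ ^ 2 * ‖mom β 1 z‖ ≤ K ∧ ‖z‖ ^ 2 * ‖mom β 3 z‖ ≤ K ∧ ‖z‖ ^ 4 * ‖mom β 3 z‖ ≤ K := by
  obtain ⟨C1, hC1, h1⟩ := mom_bound β hβ 1
  obtain ⟨C3, hC3, h3⟩ := mom_bound β hβ 3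
  obtain ⟨C5, hC5, h5⟩ := mom_bound β hβ 5
  obtain ⟨C7, hC7, h7⟩ := mom_bound β hβ 7
  set K1 := 1 + 3 * β * C1 + β ^ 2 * C3 with hK1
  set K3 := 6 * C1 + 7 * β * C3 + β ^ 2 * C5 with hK3
  set K5 := 20 * C3 + 11 * β * C5 + β ^ 2 * C7 with hK5
  have e3 : ∀ z, z ^ 2 * mom β 3 z = 6 * mom β 1 z - 7 * β * mom β 3 z + β ^ 2 * mom β 5 z := by
    intro z
    have a1 := mom_rec β hβ 1 z
    have a2 := mom_rec β hβ 2 z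
    have a3 := mom_rec β hβ 3 z
    norm_num at a1 a2 a3
    linear_combination z * a2 + 3 * a1 - β * a3
  have e5 : ∀ z, z ^ 2 * mom β 5 z = 20 * mom β 3 z - 11 * β * mom β 5 z + β ^ 2 * mom β 7 z := by
    intro z
    have a1 := mom_rec β hβ 3 z
    have a2 := mom_rec β hβ 4 z
    have a3 := mom_rec β hβ 5 z
    norm_num at a1 a2 a3
    linear_combination z * a2 + 5 * a1 - β * a3
  have e1 : ∀ z, z ^ 2 * mom β 1 z = 1 - 3 * β * mom β 1 z + β ^ 2 * mom β 3 z := by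
    intro z
    linear_combination - mom_key β hβ z
  have tri : ∀ a b c : ℂ, ‖a - b + c‖ ≤ ‖a‖ + ‖b‖ + ‖c‖ := fun a b c =>
    (norm_add_le _ _).trans (add_le_add_left (norm_sub_le _ _) _)
  have hβn : ‖(β:ℂ)‖ = β := by rw [Complex.norm_real, Real.norm_of_nonneg hβ.le]
  have b1 : ∀ z : ℂ, -1 ≤ z.re → ‖z ^ 2 * mom β 1 z‖ ≤ K1 := by
    intro z hz
    rw [e1]
    refine (tri _ _ _).trans ?_
    simp only [norm_mul, norm_pow, hβn, norm_one, Complex.norm_ofNat]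
    have := h1 z hz; have := h3 z hz
    rw [hK1]; gcongr
  have b3 : ∀ z : ℂ, -1 ≤ z.re → ‖z ^ 2 * mom β 3 z‖ ≤ K3 := by
    intro z hz
    rw [e3]
    refine (tri _ _ _).trans ?_
    simp only [norm_mul, norm_pow, hβn, norm_one, Complex.norm_ofNat]
    have := h1 z hz; have := h3 z hz; have := h5 z hz
    rw [hK3]; gcongr
  have b5 : ∀ z : ℂ, -1 ≤ z.re → ‖z ^ 2 * mom β 5 z‖ ≤ K5 := by
    intro z hz
    rw [e5]
    refine (tri _ _ _).trans ?_
    simp only [norm_mul, norm_pow, hβn, norm_one, Complex.norm_ofNat]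
    have := h7 z hz; have := h3 z hz; have := h5 z hz
    rw [hK5]; gcongr
  have b4 : ∀ z : ℂ, -1 ≤ z.re → ‖z ^ 4 * mom β 3 z‖ ≤ 6 * K1 + 7 * β * K3 + β ^ 2 * K5 := by
    intro z hz
    have : z ^ 4 * mom β 3 z = 6 * (z ^ 2 * mom β 1 z) - 7 * β * (z ^ 2 * mom β 3 z)
        + β ^ 2 * (z ^ 2 * mom β 5 z) := by linear_combination z ^ 2 * e3 z
    rw [this]
    refine (tri _ _ _).trans ?_
    rw [norm_mul 6, norm_mul _ (z ^ 2 * mom β 3 z), norm_mul _ (z ^ 2 * mom β 5 z)]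
    have := b1 z hz; have := b3 z hz; have := b5 z hz
    simp only [norm_mul (7:ℂ), norm_pow (β:ℂ), hβn, Complex.norm_ofNat]
    gcongr
  have p1 : 1 ≤ K1 := by have : 0 ≤ 3 * β * C1 + β ^ 2 * C3 := by positivity
                         linarith
  have p3 : 0 ≤ K3 := by positivity
  have p5 : 0 ≤ K5 := by positivity
  have p4 : 0 ≤ 7 * β * K3 + β ^ 2 * K5 := by positivity
  refine ⟨6 * K1 + 7 * β * K3 + β ^ 2 * K5 + K3, by linarith, fun z hz => ⟨?_, ?_, ?_⟩⟩
  · have := b1 z hz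
    rw [norm_mul, norm_pow] at this
    linarith
  · have := b3 z hz
    rw [norm_mul, norm_pow] at this
    linarith
  · have := b4 z hz
    rw [norm_mul, norm_pow] at this
    linarith

lemma qf_bound (β : ℝ) (hβ : 0 < β) : ∃ δ > (0:ℝ), δ ≤ 1 ∧ ∃ C > (0:ℝ), ∀ z : ℂ, -(3 * δ) ≤ z.re →
    mom β 1 z ≠ 0 ∧ ‖qf β z‖ ≤ C / (1 + ‖z‖ ^ 2) := by
  obtain ⟨K, hK, hdec⟩ := mom_decay β hβ
  set A : ℝ := 1 + 2 * (3 * β + β ^ 2) * K with hA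
  have hK0 : 0 < K := by linarith
  have hA1 : 1 ≤ A := by have : 0 ≤ 2 * (3 * β + β ^ 2) * K := by positivity
                         linarith
  have hlarge : ∀ z : ℂ, -1 ≤ z.re → A ≤ ‖z‖ → 1 / 2 ≤ ‖z‖ ^ 2 * ‖mom β 1 z‖ := by
    intro z hz hzA
    obtain ⟨d1, d2, -⟩ := hdec z hz
    have hz2 : A ≤ ‖z‖ ^ 2 := by nlinarith
    have e1 : z ^ 2 * mom β 1 z = 1 - (3 * β * mom β 1 z - β ^ 2 * mom β 3 z) := by
      linear_combination - mom_key β hβ z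
    have hβn : ‖(β:ℂ)‖ = β := by rw [Complex.norm_real, Real.norm_of_nonneg hβ.le]
    have hs : ‖3 * β * mom β 1 z - β ^ 2 * mom β 3 z‖ ≤ 3 * β * ‖mom β 1 z‖ + β ^ 2 * ‖mom β 3 z‖ := by
      refine (norm_sub_le _ _).trans ?_
      simp only [norm_mul, norm_pow, hβn, Complex.norm_ofNat]
      rfl
    have hz0 : 0 < ‖z‖ ^ 2 := by linarith
    have hs2 : 3 * β * ‖mom β 1 z‖ + β ^ 2 * ‖mom β 3 z‖ ≤ 1 / 2 := by
      have : ‖z‖ ^ 2 * (3 * β * ‖mom β 1 z‖ + β ^ 2 * ‖mom β 3 z‖) ≤ ‖z‖ ^ 2 * (1 / 2) := by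
        calc _ = 3 * β * (‖z‖ ^ 2 * ‖mom β 1 z‖) + β ^ 2 * (‖z‖ ^ 2 * ‖mom β 3 z‖) := by ring
          _ ≤ 3 * β * K + β ^ 2 * K := by gcongr
          _ ≤ A * (1 / 2) := by rw [hA]; linarith
          _ ≤ _ := by gcongr
      exact le_of_mul_le_mul_left this hz0
    have : 1 - 1 / 2 ≤ ‖z ^ 2 * mom β 1 z‖ := by
      rw [e1]
      have := norm_sub_norm_le (1:ℂ) (3 * β * mom β 1 z - β ^ 2 * mom β 3 z)
      rw [norm_one] at this
      linarith
    rw [norm_mul, norm_pow] at this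
    linarith
  -- zero free strip
  have hδ : ∃ δ > (0:ℝ), 3 * δ ≤ 1 ∧ ∀ z : ℂ, -(3 * δ) ≤ z.re → mom β 1 z ≠ 0 := by
    set S : Set ℂ := Metric.closedBall 0 A ∩ ({z | -1 ≤ z.re} ∩ {z | mom β 1 z = 0}) with hS
    have hSc : IsCompact S := by
      refine (isCompact_closedBall 0 A).inter_right (IsClosed.inter ?_ ?_)
      · exact isClosed_le continuous_const Complex.continuous_re
      · exact isClosed_eq (mom_cont β hβ 1) continuous_const
    have hcover : ∀ z : ℂ, -1 ≤ z.re → mom β 1 z = 0 → z ∈ S := by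
      intro z hz h0
      refine ⟨?_, hz, h0⟩
      rw [mem_closedBall_zero_iff]
      by_contra hlt
      have := hlarge z hz (not_le.mp hlt).le
      rw [h0] at this
      norm_num at this
    rcases S.eq_empty_or_nonempty with he | hne
    · refine ⟨1/3, by norm_num, by norm_num, fun z hz h0 => ?_⟩
      have := hcover z (by linarith) h0
      rw [he] at this; exact this
    · obtain ⟨z0, hz0, hmax⟩ := hSc.exists_isMaxOn hne Complex.continuous_re.continuousOn
      have hneg : z0.re < 0 := by
        by_contra hge
        have := penrose β hβ z0 (not_lt.mp hge) 0 le_rfl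
        apply this
        rw [hz0.2.2]; simp
      have h1 : -1 ≤ z0.re := hz0.2.1
      refine ⟨-z0.re / 6, by linarith, by linarith, fun z hz h0 => ?_⟩
      have hm : z.re ≤ z0.re := hmax (hcover z (by linarith) h0)
      linarith
  obtain ⟨δ, hδ0, hδ1, hnz⟩ := hδ
  set T : Set ℂ := Metric.closedBall 0 A ∩ {z | -(3 * δ) ≤ z.re} with hT
  have hTc : IsCompact T := (isCompact_closedBall 0 A).inter_right
    (isClosed_le continuous_const Complex.continuous_re)
  have hcont : ContinuousOn (fun z => qf β z * ((1 + ‖z‖ ^ 2 : ℝ) : ℂ)) T := by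
    intro z hz
    refine ContinuousAt.continuousWithinAt ?_
    refine (qf_diff β hβ z (hnz z hz.2)).continuousAt.mul ?_
    fun_prop
  obtain ⟨C, hC⟩ := hTc.exists_bound_of_continuousOn hcont
  refine ⟨δ, hδ0, by linarith, |C| + 4 * β ^ 2 * K, by positivity, fun z hz => ⟨hnz z hz, ?_⟩⟩
  have hpos : 0 < 1 + ‖z‖ ^ 2 := by positivity
  rw [le_div_iff₀ hpos]
  by_cases hzA : ‖z‖ ≤ A
  · have := hC z ⟨by rwa [mem_closedBall_zero_iff], hz⟩
    rw [norm_mul, Complex.norm_real, Real.norm_of_nonneg hpos.le] at this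
    have h2 := le_abs_self C
    have : 0 ≤ 4 * β ^ 2 * K := by positivity
    linarith
  · have hzA' := (not_le.mp hzA).le
    have hz1 : -1 ≤ z.re := by linarith
    obtain ⟨-, -, d4⟩ := hdec z hz1
    have hl := hlarge z hz1 hzA'
    have hm : 0 < ‖mom β 1 z‖ := norm_pos_iff.mpr (hnz z hz)
    have hβn : ‖(β:ℂ)‖ = β := by rw [Complex.norm_real, Real.norm_of_nonneg hβ.le]
    have hq : ‖qf β z‖ = β ^ 2 * ‖mom β 3 z‖ / ‖mom β 1 z‖ := by
      unfold qf; rw [norm_div, norm_mul, norm_neg, norm_pow, hβn]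
    have hz2 : 1 ≤ ‖z‖ ^ 2 := by nlinarith
    have key : ‖qf β z‖ * (1 + ‖z‖ ^ 2) ≤ 4 * β ^ 2 * K := by
      rw [hq, div_mul_eq_mul_div, div_le_iff₀ hm]
      have hz4 : 0 < ‖z‖ ^ 2 := by linarith
      have : ‖z‖ ^ 2 * (β ^ 2 * ‖mom β 3 z‖ * (1 + ‖z‖ ^ 2)) ≤ ‖z‖ ^ 2 * (4 * β ^ 2 * K * ‖mom β 1 z‖) := by
        calc _ ≤ ‖z‖ ^ 2 * (β ^ 2 * ‖mom β 3 z‖ * (‖z‖ ^ 2 + ‖z‖ ^ 2)) := by gcongr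
          _ = 2 * β ^ 2 * (‖z‖ ^ 4 * ‖mom β 3 z‖) := by ring
          _ ≤ 2 * β ^ 2 * K := by gcongr
          _ = 4 * β ^ 2 * K * (1 / 2) := by ring
          _ ≤ 4 * β ^ 2 * K * (‖z‖ ^ 2 * ‖mom β 1 z‖) := by gcongr
          _ = _ := by ring
      exact le_of_mul_le_mul_left this hz4
    have := abs_nonneg C
    linarith

open MeasureTheory Complex

lemma lorentz (a η : ℝ) (ha : 0 < a) :
    Integrable (fun y : ℝ => 1 / (a ^ 2 + (y - η) ^ 2)) ∧
    ∫ y : ℝ, 1 / (a ^ 2 + (y - η) ^ 2) = Real.pi / a := by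
  have h : (fun y : ℝ => 1 / (a ^ 2 + (y - η) ^ 2)) =
      fun y => (fun u : ℝ => (a ^ 2)⁻¹ * (1 + (a⁻¹ * u) ^ 2)⁻¹) (y - η) := by
    ext y
    field_simp
  rw [h]
  constructor
  · refine Integrable.comp_sub_right (f := fun u : ℝ => (a ^ 2)⁻¹ * (1 + (a⁻¹ * u) ^ 2)⁻¹) ?_ η
    exact (integrable_inv_one_add_sq.comp_mul_left' (inv_ne_zero ha.ne')).const_mul _
  · rw [integral_sub_right_eq_self (fun u : ℝ => (a ^ 2)⁻¹ * (1 + (a⁻¹ * u) ^ 2)⁻¹) η,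
      integral_const_mul, Measure.integral_comp_mul_left (fun u : ℝ => (1 + u ^ 2)⁻¹),
      integral_univ_inv_one_add_sq]
    simp only [inv_inv, smul_eq_mul, abs_of_pos ha]
    field_simp

lemma line_integrable (f : ℝ → ℂ) (hf : Continuous f) (A C : ℝ)
    (h : ∀ y : ℝ, A ≤ |y| → ‖f y‖ ≤ C / y ^ 2) : Integrable f := by
  obtain ⟨K, hK⟩ := (isCompact_Icc (a := -(|A| + 1)) (b := |A| + 1)).exists_bound_of_continuousOn
    (f := fun y : ℝ => f y * ((1 + y ^ 2 : ℝ) : ℂ)) (by fun_prop)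
  refine (integrable_inv_one_add_sq.const_mul (|K| + 2 * |C|)).mono' hf.aestronglyMeasurable
    (Filter.Eventually.of_forall fun y => ?_)
  have hp : 0 < 1 + y ^ 2 := by positivity
  rw [← div_eq_mul_inv, le_div_iff₀ hp]
  by_cases hy : |y| ≤ |A| + 1
  · have := hK y (abs_le.mp hy)
    rw [norm_mul, Complex.norm_real, Real.norm_of_nonneg hp.le] at this
    have := le_abs_self K
    have := abs_nonneg C
    linarith
  · have hy' := not_le.mp hy
    have h1 := h y (by have := le_abs_self A; linarith)
    have h2 : 1 ≤ y ^ 2 := by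
      rw [← sq_abs]
      have := abs_nonneg A
      nlinarith
    have h3 : ‖f y‖ ≤ |C| / y ^ 2 := h1.trans (by gcongr; exact le_abs_self C)
    rw [le_div_iff₀ (by linarith)] at h3
    have := abs_nonneg K
    nlinarith [norm_nonneg (f y)]

lemma halfplane_zero (V : ℂ → ℂ) (x0 A C : ℝ) (hV : DifferentiableOn ℂ V {z | x0 ≤ z.re})
    (hd : ∀ z : ℂ, x0 ≤ z.re → A ≤ ‖z‖ → ‖V z‖ ≤ C / ‖z‖ ^ 2) :
    Integrable (fun y : ℝ => V (x0 + y * I)) ∧ ∫ y : ℝ, V (x0 + y * I) = 0 := by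
  have hintg : Integrable (fun y : ℝ => V (x0 + y * I)) := by
    refine line_integrable _ ?_ (max A 1) |C| ?_
    · refine hV.continuousOn.comp_continuous (by fun_prop) (fun y => ?_)
      simp
    · intro y hy
      have h1 : |y| ≤ ‖(x0 + y * I : ℂ)‖ := by
        have := Complex.abs_im_le_norm (x0 + y * I : ℂ)
        simpa using this
      have h2 : 1 ≤ |y| := (le_max_right _ _).trans hy
      refine (hd (x0 + y * I) (by simp) (((le_max_left _ _).trans hy).trans h1)).trans ?_
      rw [← sq_abs y]
      calc C / ‖(x0 + y * I : ℂ)‖ ^ 2 ≤ |C| / ‖(x0 + y * I : ℂ)‖ ^ 2 := by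
            gcongr; exact le_abs_self C
        _ ≤ _ := by gcongr
  refine ⟨hintg, ?_⟩
  have hlim := intervalIntegral_tendsto_integral hintg
    (Filter.tendsto_neg_atTop_atBot (G := ℝ)) Filter.tendsto_id
  simp only [id] at hlim
  refine tendsto_nhds_unique hlim ?_
  have hb : Filter.Tendsto (fun X : ℝ => 6 * |C| / X) Filter.atTop (nhds 0) :=
    tendsto_const_nhds.div_atTop Filter.tendsto_id
  refine squeeze_zero_norm' ?_ hb
  filter_upwards [Filter.eventually_ge_atTop A, Filter.eventually_ge_atTop (|x0| + 1)] with X hXA hX1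
  have hX0 : 0 < X := by have := abs_nonneg x0; linarith
  have hx0X : x0 ≤ X := by have := le_abs_self x0; linarith
  have hx0X' : -X ≤ x0 := by have := neg_abs_le x0; linarith
  have hrect := Complex.integral_boundary_rect_eq_zero_of_differentiableOn V
    (⟨x0, -X⟩ : ℂ) (⟨X, X⟩ : ℂ) (hV.mono (by
      intro z hz
      have := hz.1
      simp only [Set.mem_preimage, Set.uIcc_of_le hx0X] at this
      exact this.1))
  simp only [smul_eq_mul] at hrect
  have hbd : ∀ z : ℂ, x0 ≤ z.re → X ≤ ‖z‖ → ‖V z‖ ≤ |C| / X ^ 2 := by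
    intro z hz hzX
    refine (hd z hz (hXA.trans hzX)).trans ?_
    calc C / ‖z‖ ^ 2 ≤ |C| / ‖z‖ ^ 2 := by gcongr; exact le_abs_self C
      _ ≤ _ := by gcongr
  have I1 : ‖∫ x in x0..X, V (x + ((-X : ℝ) : ℂ) * I)‖ ≤ |C| / X ^ 2 * |X - x0| := by
    refine intervalIntegral.norm_integral_le_of_norm_le_const (fun x hx => ?_)
    rw [Set.uIoc_of_le hx0X] at hx
    refine hbd _ (by simpa using hx.1.le) ?_
    have := Complex.abs_im_le_norm (x + ((-X : ℝ) : ℂ) * I)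
    simpa [abs_of_pos hX0] using this
  have I2 : ‖∫ x in x0..X, V (x + (X : ℂ) * I)‖ ≤ |C| / X ^ 2 * |X - x0| := by
    refine intervalIntegral.norm_integral_le_of_norm_le_const (fun x hx => ?_)
    rw [Set.uIoc_of_le hx0X] at hx
    refine hbd _ (by simpa using hx.1.le) ?_
    have := Complex.abs_im_le_norm (x + (X : ℂ) * I)
    simpa [abs_of_pos hX0] using this
  have I3 : ‖∫ y in (-X)..X, V (X + (y : ℂ) * I)‖ ≤ |C| / X ^ 2 * |X - -X| := by
    refine intervalIntegral.norm_integral_le_of_norm_le_const (fun y hy => ?_)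
    refine hbd _ (by simpa using hx0X) ?_
    have := Complex.abs_re_le_norm (X + (y : ℂ) * I)
    simpa [abs_of_pos hX0] using this
  have e : I * ∫ y in (-X)..X, V (x0 + (y : ℂ) * I) =
      (∫ x in x0..X, V (x + ((-X : ℝ) : ℂ) * I)) - (∫ x in x0..X, V (x + (X : ℂ) * I)) +
      I * ∫ y in (-X)..X, V (X + (y : ℂ) * I) := by
    linear_combination -hrect
  have en : ‖∫ y in (-X)..X, V (x0 + (y : ℂ) * I)‖ = ‖I * ∫ y in (-X)..X, V (x0 + (y : ℂ) * I)‖ := by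
    rw [norm_mul, Complex.norm_I, one_mul]
  rw [en, e]
  refine (norm_add_le _ _).trans ?_
  rw [norm_mul, Complex.norm_I, one_mul]
  have h4 := norm_sub_le (∫ x in x0..X, V (x + ((-X : ℝ) : ℂ) * I)) (∫ x in x0..X, V (x + (X : ℂ) * I))
  have h5 : |X - x0| ≤ 2 * X := by rw [abs_of_nonneg (by linarith)]; linarith
  have h6 : |X - -X| ≤ 2 * X := by rw [abs_of_nonneg (by linarith)]; linarith
  have h7 : |C| / X ^ 2 * |X - x0| ≤ |C| / X ^ 2 * (2 * X) := by gcongr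
  have h8 : |C| / X ^ 2 * |X - -X| ≤ |C| / X ^ 2 * (2 * X) := by gcongr
  have h9 : 6 * |C| / X = 3 * (|C| / X ^ 2 * (2 * X)) := by field_simp; ring
  rw [h9]
  linarith

lemma norm_sub_half (w c : ℂ) (h : 2 * ‖c‖ ≤ ‖w‖) : ‖w‖ / 2 ≤ ‖w - c‖ := by
  have := norm_sub_norm_le w c
  linarith

lemma halfplane_cauchy (F : ℂ → ℂ) (x0 x1 A C : ℝ) (hx : x1 < x0)
    (hF : DifferentiableOn ℂ F {z | x1 < z.re})
    (hd : ∀ z : ℂ, x0 ≤ z.re → A ≤ ‖z‖ → ‖F z‖ ≤ C / ‖z‖) (l : ℂ) (hl : x0 < l.re) :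
    Integrable (fun y : ℝ => F (x0 + y * I) / (l - (x0 + y * I))) ∧
    ∫ y : ℝ, F (x0 + y * I) / (l - (x0 + y * I)) = 2 * Real.pi * F l := by
  set ls : ℂ := 2 * x0 - starRingEnd ℂ l with hls
  have hlsre : ls.re = 2 * x0 - l.re := by simp [hls]
  set V : ℂ → ℂ := fun m => - dslope F l m - F l / (m - ls) with hVdef
  have hopen : IsOpen {z : ℂ | x1 < z.re} := isOpen_lt continuous_const Complex.continuous_re
  have hVd : DifferentiableOn ℂ V {z | x0 ≤ z.re} := by
    have h1 : DifferentiableOn ℂ (dslope F l) {z | x1 < z.re} :=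
      (Complex.differentiableOn_dslope (hopen.mem_nhds (by simp; linarith))).mpr hF
    have h2 : DifferentiableOn ℂ (fun m => F l / (m - ls)) {z | x0 ≤ z.re} := by
      refine DifferentiableOn.div (by fun_prop) (by fun_prop) (fun m hm h => ?_)
      have hm' : x0 ≤ m.re := hm
      have := congrArg Complex.re h
      simp [hlsre] at this
      linarith
    exact (h1.mono (fun z (hz : x0 ≤ z.re) => show x1 < z.re by linarith)).neg.sub h2
  have hVeq : ∀ m : ℂ, x0 ≤ m.re → m ≠ l →
      V m = F m / (l - m) - F l * (l - ls) / ((l - m) * (m - ls)) := by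
    intro m hm hml
    have h1 : l - m ≠ 0 := sub_ne_zero.mpr (Ne.symm hml)
    have h1' : m - l ≠ 0 := sub_ne_zero.mpr hml
    have h2 : m - ls ≠ 0 := by
      intro h
      have := congrArg Complex.re h
      simp [hlsre] at this
      linarith
    simp only [hVdef]
    rw [dslope_of_ne _ hml, slope_def_field]
    have : (F m - F l) / (m - l) = - ((F m - F l) / (l - m)) := by
      rw [← neg_sub l m, div_neg]
    rw [this]
    field_simp
    ring
  obtain ⟨hVi, hV0⟩ := halfplane_zero V x0 (max A (2 * ‖l‖ + 2 * ‖ls‖ + 1))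
    (2 * |C| + 4 * ‖F l * (l - ls)‖) hVd (by
    intro z hz hzA
    have hzA1 : A ≤ ‖z‖ := (le_max_left _ _).trans hzA
    have hzA2 : 2 * ‖l‖ + 2 * ‖ls‖ + 1 ≤ ‖z‖ := (le_max_right _ _).trans hzA
    have nl := norm_nonneg l
    have nls := norm_nonneg ls
    have hz0 : 0 < ‖z‖ := by linarith
    have hzl : z ≠ l := by rintro rfl; linarith
    rw [hVeq z hz hzl]
    refine (norm_sub_le _ _).trans ?_
    have b1 : ‖z‖ / 2 ≤ ‖l - z‖ := by rw [norm_sub_rev]; exact norm_sub_half z l (by linarith)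
    have b2 : ‖z‖ / 2 ≤ ‖z - ls‖ := norm_sub_half z ls (by linarith)
    have b3 : ‖F z‖ ≤ |C| / ‖z‖ := (hd z hz hzA1).trans (by gcongr; exact le_abs_self C)
    rw [norm_div, norm_div, norm_mul (l - z)]
    calc ‖F z‖ / ‖l - z‖ + ‖F l * (l - ls)‖ / (‖l - z‖ * ‖z - ls‖)
        ≤ (|C| / ‖z‖) / (‖z‖ / 2) + ‖F l * (l - ls)‖ / ((‖z‖ / 2) * (‖z‖ / 2)) := by gcongr
      _ = _ := by field_simp; ring)
  set a : ℝ := l.re - x0 with ha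
  have hapos : 0 < a := by linarith
  obtain ⟨li, lv⟩ := lorentz a l.im hapos
  have hline : ∀ y : ℝ, F (x0 + y * I) / (l - (x0 + y * I)) =
      V (x0 + y * I) + F l * ((2 * a * (1 / (a ^ 2 + (y - l.im) ^ 2)) : ℝ) : ℂ) := by
    intro y
    have hne : (x0 + y * I : ℂ) ≠ l := by
      intro h
      have := congrArg Complex.re h
      simp at this; linarith
    rw [hVeq _ (by simp) hne]
    have e1 : (l - (x0 + y * I)) * ((x0 + y * I) - ls) = ((a ^ 2 + (y - l.im) ^ 2 : ℝ) : ℂ) := by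
      apply Complex.ext
      · rw [Complex.ofReal_re]; simp [hls, ha]; ring
      · rw [Complex.ofReal_im]; simp [hls]; ring
    have e2 : l - ls = ((2 * a : ℝ) : ℂ) := by
      apply Complex.ext
      · simp [hls, ha]; ring
      · simp [hls]
    rw [e1, e2]
    push_cast
    ring
  simp_rw [hline]
  have li2 : Integrable (fun y : ℝ => F l * ((2 * a * (1 / (a ^ 2 + (y - l.im) ^ 2)) : ℝ) : ℂ)) :=
    ((li.const_mul (2 * a)).ofReal).const_mul (F l)
  refine ⟨hVi.add li2, ?_⟩
  rw [integral_add hVi li2, hV0, integral_const_mul, integral_complex_ofReal, integral_const_mul, lv]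
  have : 2 * a * (Real.pi / a) = 2 * Real.pi := by field_simp
  rw [this]
  push_cast; ring

lemma two_poles (x0 : ℝ) (l c : ℂ) (hl : x0 < l.re) (hc : x0 < c.re) :
    Integrable (fun y : ℝ => 1 / ((x0 + y * I) - c) / (l - (x0 + y * I))) ∧
    ∫ y : ℝ, 1 / ((x0 + y * I) - c) / (l - (x0 + y * I)) = 0 := by
  set V : ℂ → ℂ := fun m => 1 / ((2 * x0 - m) - c) / (l - (2 * x0 - m)) with hV
  have ne1 : ∀ m : ℂ, x0 ≤ m.re → (2 * x0 - m) - c ≠ 0 := by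
    intro m hm h
    have := congrArg Complex.re h
    simp at this; linarith
  have ne2 : ∀ m : ℂ, x0 ≤ m.re → l - (2 * x0 - m) ≠ 0 := by
    intro m hm h
    have := congrArg Complex.re h
    simp at this; linarith
  obtain ⟨h1, h2⟩ := halfplane_zero V x0 (2 * ‖2 * x0 - c‖ + 2 * ‖2 * x0 - l‖ + 1) 4 (by
      refine DifferentiableOn.div (DifferentiableOn.div (by fun_prop) (by fun_prop) ne1) (by fun_prop) ne2) (by
      intro z hz hzA
      have n1 := norm_nonneg (2 * x0 - c)
      have n2 := norm_nonneg (2 * x0 - l)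
      have hz0 : 0 < ‖z‖ := by linarith
      have b1 : ‖z‖ / 2 ≤ ‖(2 * x0 - z) - c‖ := by
        rw [← norm_neg ((2 * x0 - z) - c)]
        have : -((2 * x0 - z) - c) = z - (2 * x0 - c) := by ring
        rw [this]; exact norm_sub_half _ _ (by linarith)
      have b2 : ‖z‖ / 2 ≤ ‖l - (2 * x0 - z)‖ := by
        have : l - (2 * x0 - z) = z - (2 * x0 - l) := by ring
        rw [this]; exact norm_sub_half _ _ (by linarith)
      simp only [hV]
      rw [norm_div, norm_div, norm_one]
      calc 1 / ‖2 * x0 - z - c‖ / ‖l - (2 * x0 - z)‖ ≤ 1 / (‖z‖ / 2) / (‖z‖ / 2) := by gcongr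
        _ = _ := by field_simp; norm_num)
  have e : (fun y : ℝ => 1 / ((x0 + y * I) - c) / (l - (x0 + y * I))) =
      fun y : ℝ => (fun y : ℝ => V (x0 + y * I)) (-y) := by
    ext y
    simp only [hV]
    have : (2 * x0 - (x0 + ((-y : ℝ) : ℂ) * I) : ℂ) = x0 + y * I := by push_cast; ring
    rw [this]
  rw [e]
  refine ⟨h1.comp_neg, ?_⟩
  rw [integral_neg_eq_self (fun y : ℝ => V (x0 + y * I))]
  exact h2

lemma exists_zero (D : ℂ → ℂ) (z0 : ℂ) (r ε : ℝ) (hr : 0 < r)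
    (hD : ∀ z ∈ Metric.closedBall z0 r, DifferentiableAt ℂ D z)
    (hs : ∀ z ∈ Metric.sphere z0 r, ε ≤ ‖D z‖) (h0 : ‖D z0‖ < ε) :
    ∃ z ∈ Metric.closedBall z0 r, D z = 0 := by
  by_contra! hne
  have hε : 0 < ε := (norm_nonneg _).trans_lt h0
  have hdiff : DiffContOnCl ℂ (fun z => 1 / D z) (Metric.ball z0 r) := by
    refine DifferentiableOn.diffContOnCl ?_
    rw [closure_ball z0 hr.ne']
    intro z hz
    exact ((differentiableAt_const 1).div (hD z hz) (hne z hz)).differentiableWithinAt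
  have := Complex.norm_le_of_forall_mem_frontier_norm_le Metric.isBounded_ball hdiff (C := 1 / ε) (by
    intro z hz
    rw [frontier_ball z0 hr.ne'] at hz
    rw [norm_div, norm_one]
    have := hs z hz
    gcongr) (z := z0) (by
      rw [closure_ball z0 hr.ne']; exact Metric.mem_closedBall_self hr.le)
  rw [norm_div, norm_one] at this
  have hp : 0 < ‖D z0‖ := norm_pos_iff.mpr (hne z0 (Metric.mem_closedBall_self hr.le))
  have := (one_div_le_one_div hp hε).mp this
  linarith

lemma partial_fractions (D : ℂ → ℂ) (U : Set ℂ) (hU : IsOpen U) (p c : ℂ) (hp : p ∈ U) (hc : c ∈ U)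
    (hpc : p ≠ c) (hD : DifferentiableOn ℂ D U) (hDp : D p = 0) (hDc : D c = 0)
    (hD' : ∀ z ∈ U, D z = 0 → z = p ∨ z = c) (hdp : deriv D p ≠ 0) (hdc : deriv D c ≠ 0) :
    ∃ F : ℂ → ℂ, DifferentiableOn ℂ F U ∧ ∀ z ∈ U, z ≠ p → z ≠ c →
      F z = 1 / D z - (1 / deriv D p) / (z - p) - (1 / deriv D c) / (z - c) := by
  have hUp := hU.mem_nhds hp
  have hUc := hU.mem_nhds hc
  set D1 := dslope D p with hD1
  set g := dslope D1 c with hg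
  have dD1 : DifferentiableOn ℂ D1 U := (Complex.differentiableOn_dslope hUp).mpr hD
  have dg : DifferentiableOn ℂ g U := (Complex.differentiableOn_dslope hUc).mpr dD1
  have e1 : ∀ z, D z = (z - p) * D1 z := by
    intro z
    have := sub_smul_dslope D p z
    rw [hDp, sub_zero, smul_eq_mul] at this
    exact this.symm
  have hD1c : D1 c = 0 := by
    have := e1 c
    rw [hDc] at this
    exact (mul_eq_zero.mp this.symm).resolve_left (sub_ne_zero.mpr hpc.symm)
  have e2 : ∀ z, D1 z = (z - c) * g z := by
    intro z
    have := sub_smul_dslope D1 c z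
    rw [hD1c, sub_zero, smul_eq_mul] at this
    exact this.symm
  have dp : deriv D p = (p - c) * g p := by
    rw [← e2, hD1, dslope_same]
  have dc : deriv D c = (c - p) * g c := by
    have h1 : HasDerivAt D1 (g c) c := by
      rw [hg, dslope_same]
      exact (dD1.differentiableAt hUc).hasDerivAt
    have h2 := ((hasDerivAt_id c).sub_const p).mul h1
    have h3 : (fun z => (id z - p)) * D1 = D := by
      ext z; simp [e1 z]
    rw [h3] at h2
    rw [h2.deriv, hD1c]; simp
  have gp : g p ≠ 0 := by intro h; rw [dp, h, mul_zero] at hdp; exact hdp rfl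
  have gc : g c ≠ 0 := by intro h; rw [dc, h, mul_zero] at hdc; exact hdc rfl
  have gne : ∀ z ∈ U, g z ≠ 0 := by
    intro z hz h
    have : D z = 0 := by rw [e1, e2, h]; ring
    rcases hD' z hz this with rfl | rfl
    · exact gp h
    · exact gc h
  set h : ℂ → ℂ := fun z => 1 / g z with hh
  have dh : DifferentiableOn ℂ h U := DifferentiableOn.div (by fun_prop) dg gne
  refine ⟨dslope (dslope h p) c, (Complex.differentiableOn_dslope hUc).mpr
    ((Complex.differentiableOn_dslope hUp).mpr dh), fun z hz hzp hzc => ?_⟩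
  have n1 : z - p ≠ 0 := sub_ne_zero.mpr hzp
  have n2 : z - c ≠ 0 := sub_ne_zero.mpr hzc
  have n3 : c - p ≠ 0 := sub_ne_zero.mpr hpc.symm
  have n4 : p - c ≠ 0 := sub_ne_zero.mpr hpc
  have n5 := gne z hz
  rw [dslope_of_ne _ hzc, slope_def_field, dslope_of_ne _ hzp, dslope_of_ne _ hpc.symm,
    slope_def_field, slope_def_field, dp, dc, e1 z, e2 z]
  simp only [hh]
  have : p - c = -(c - p) := by ring
  rw [this]
  field_simp
  ring

open MeasureTheory Complex

structure QHyp (q : ℂ → ℂ) (β δ Cq L : ℝ) : Prop where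
  hβ : 0 < β
  hδ : 0 < δ
  hC : 0 < Cq
  hL : 0 < L
  diff : ∀ z : ℂ, -(2 * δ) ≤ z.re → DifferentiableAt ℂ q z
  bd : ∀ z : ℂ, -(2 * δ) ≤ z.re → ‖q z‖ ≤ Cq / (1 + ‖z‖ ^ 2)
  bd' : ∀ z : ℂ, -(2 * δ) ≤ z.re → ‖deriv q z‖ ≤ L / (1 + ‖z‖ ^ 2)
  cj : ∀ z : ℂ, q (starRingEnd ℂ z) = starRingEnd ℂ (q z)
  pen : ∀ z : ℂ, 0 ≤ z.re → ∀ c : ℝ, 0 < c → z ^ 2 + 3 * β + q z + c ≠ 0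

lemma QHyp.bd1 {q : ℂ → ℂ} {β δ Cq L : ℝ} (Q : QHyp q β δ Cq L) (z : ℂ) (hz : -(2 * δ) ≤ z.re) :
    ‖q z‖ ≤ Cq := by
  refine (Q.bd z hz).trans (div_le_self Q.hC.le ?_)
  have := sq_nonneg ‖z‖; linarith

lemma QHyp.lip {q : ℂ → ℂ} {β δ Cq L : ℝ} (Q : QHyp q β δ Cq L) (z w : ℂ)
    (hz : -(2 * δ) ≤ z.re) (hw : -(2 * δ) ≤ w.re) : ‖q z - q w‖ ≤ L * ‖z - w‖ := by
  have hconv : Convex ℝ {z : ℂ | -(2 * δ) ≤ z.re} := convex_halfSpace_re_ge _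
  refine hconv.norm_image_sub_le_of_norm_deriv_le (f := q) (fun x hx => Q.diff x hx) (fun x hx => ?_) hw hz
  refine (Q.bd' x hx).trans (div_le_self Q.hL.le ?_)
  have := sq_nonneg ‖x‖; linarith

lemma exists_QHyp (β : ℝ) (hβ : 0 < β) : ∃ δ Cq L : ℝ, QHyp (qf β) β δ Cq L ∧
    ∀ z : ℂ, -(2 * δ) ≤ z.re → mom β 1 z ≠ 0 := by
  obtain ⟨δ, hδ, hδ1, C, hC, h⟩ := qf_bound β hβ
  refine ⟨δ, C, 3 * C / δ, ⟨hβ, hδ, hC, by positivity, ?_, ?_, ?_, ?_, ?_⟩, ?_⟩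
  · intro z hz
    exact qf_diff β hβ z (h z (by linarith)).1
  · intro z hz
    exact (h z (by linarith)).2
  · intro z hz
    have hre : ∀ w ∈ Metric.closedBall z δ, -(3 * δ) ≤ w.re := by
      intro w hw
      rw [Metric.mem_closedBall, dist_eq_norm] at hw
      have := (abs_le.mp ((Complex.abs_re_le_norm (w - z)).trans hw)).1
      rw [Complex.sub_re] at this
      linarith
    have hd : DiffContOnCl ℂ (qf β) (Metric.ball z δ) := by
      refine DifferentiableOn.diffContOnCl ?_
      rw [closure_ball z hδ.ne']
      intro w hw
      exact (qf_diff β hβ w (h w (hre w hw)).1).differentiableWithinAt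
    have := Complex.norm_deriv_le_of_forall_mem_sphere_norm_le hδ hd (C := 3 * C / (1 + ‖z‖ ^ 2)) (by
      intro w hw
      refine (h w (hre w (Metric.sphere_subset_closedBall hw))).2.trans ?_
      rw [div_le_div_iff₀ (by positivity) (by positivity)]
      rw [mem_sphere_iff_norm] at hw
      have h1 : ‖z‖ ≤ ‖w‖ + 1 := by
        have := norm_sub_norm_le z w
        rw [norm_sub_rev] at hw
        linarith
      have h2 : ‖z‖ ^ 2 ≤ (‖w‖ + 1) ^ 2 := by gcongr
      have h3 : 1 + ‖z‖ ^ 2 ≤ 3 * (1 + ‖w‖ ^ 2) := by nlinarith [sq_nonneg (‖w‖ - 1)]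
      nlinarith)
    refine this.trans (le_of_eq ?_)
    field_simp
  · intro z; exact qf_conj β z
  · intro z hz c hc he
    have hm := (h z (by linarith)).1
    have h1 := qf_eq β hβ z hm
    have h2 : 1 / mom β 1 z = -(c : ℂ) := by rw [h1]; linear_combination he
    have hc' : (c : ℂ) ≠ 0 := by exact_mod_cast hc.ne'
    refine penrose β hβ z hz (1 / c) (by positivity) ?_
    have : mom β 1 z = 1 / (-(c : ℂ)) := by rw [← h2]; simp
    rw [this]; push_cast; field_simp
  · intro z hz
    exact (h z (by linarith)).1

/-- dispersion function -/
noncomputable def DD (q : ℂ → ℂ) (β ω κ : ℝ) (l : ℂ) : ℂ := l ^ 2 + ω ^ 2 + κ ^ 2 * (3 * β + q (l / κ))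

lemma re_div {κ : ℝ} (hκ : 0 < κ) {a : ℝ} {l : ℂ} (h : -(a * κ) ≤ l.re) : -a ≤ (l / κ).re := by
  rw [Complex.div_ofReal_re, le_div_iff₀ hκ]; linarith

section
variable {q : ℂ → ℂ} {β δ Cq L ω κ : ℝ}

lemma DD_diff (Q : QHyp q β δ Cq L) (hκ : 0 < κ) (l : ℂ) (hl : -(2 * δ * κ) ≤ l.re) :
    HasDerivAt (DD q β ω κ) (2 * l + κ * deriv q (l / κ)) l := by
  have hk : (κ : ℂ) ≠ 0 := by exact_mod_cast hκ.ne'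
  have h1 := (Q.diff (l / κ) (re_div hκ hl)).hasDerivAt
  have h2 : HasDerivAt (fun l : ℂ => l / κ) (1 / κ) l := (hasDerivAt_id l).div_const _
  have h3 : HasDerivAt (fun l : ℂ => q (l / κ)) (deriv q (l / κ) * (1 / κ)) l :=
    HasDerivAt.comp l h1 h2
  have h4 : HasDerivAt (fun l : ℂ => l ^ 2 + (ω : ℂ) ^ 2 + κ ^ 2 * (3 * β + q (l / κ)))
      ((2 : ℕ) * l ^ (2 - 1) + κ ^ 2 * (deriv q (l / κ) * (1 / κ))) l :=
    ((hasDerivAt_pow 2 l).add_const _).add ((h3.const_add _).const_mul _)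
  refine h4.congr_deriv ?_
  field_simp
  simp [mul_comm]

lemma DD_conj (Q : QHyp q β δ Cq L) (l : ℂ) :
    DD q β ω κ (starRingEnd ℂ l) = starRingEnd ℂ (DD q β ω κ l) := by
  have := Q.cj (l / κ)
  simp only [map_div₀, Complex.conj_ofReal] at this
  have h3 : (starRingEnd ℂ) 3 = 3 := Complex.conj_ofNat 3
  simp [DD, this, h3]

lemma DD_near (Q : QHyp q β δ Cq L) (hκ : 0 < κ) (l : ℂ) (hl : -(2 * δ * κ) ≤ l.re) :
    ‖DD q β ω κ l - (l - I * ω) * (l + I * ω)‖ ≤ (3 * β + Cq) * κ ^ 2 := by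
  have e : DD q β ω κ l - (l - I * ω) * (l + I * ω) = κ ^ 2 * (3 * β + q (l / κ)) := by
    simp only [DD]; linear_combination -(ω : ℂ) ^ 2 * Complex.I_sq * (-1)
  rw [e, norm_mul, norm_pow, Complex.norm_real, Real.norm_of_nonneg hκ.le, mul_comm]
  gcongr
  refine (norm_add_le _ _).trans ?_
  have : ‖(3 * β : ℂ)‖ = 3 * β := by
    have : (3 * β : ℂ) = ((3 * β : ℝ) : ℂ) := by push_cast; ring
    rw [this, Complex.norm_real, Real.norm_of_nonneg (by linarith [Q.hβ])]
  rw [this]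
  gcongr
  exact Q.bd1 _ (re_div hκ hl)

lemma norm_ge_im (z : ℂ) : z.im ≤ ‖z‖ := (le_abs_self _).trans (Complex.abs_im_le_norm z)

lemma zero_near (Q : QHyp q β δ Cq L) (hω : 0 < ω) (hκ : 0 < κ) (l : ℂ)
    (hl : -(2 * δ * κ) ≤ l.re) (him : 0 ≤ l.im) (h0 : DD q β ω κ l = 0) :
    ‖l - I * ω‖ ≤ (3 * β + Cq) / ω * κ ^ 2 := by
  have h := DD_near (ω := ω) Q hκ l hl
  rw [h0, zero_sub, norm_neg, norm_mul] at h
  have h2 : ω ≤ ‖l + I * ω‖ := by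
    have := norm_ge_im (l + I * ω)
    simp at this; linarith
  have h3 : ‖l - I * ω‖ * ω ≤ (3 * β + Cq) * κ ^ 2 := by
    refine le_trans ?_ h
    gcongr
  rw [div_mul_eq_mul_div, le_div_iff₀ hω]
  exact h3

lemma pole_exists (Q : QHyp q β δ Cq L) (hω : 0 < ω) (hκ : 0 < κ) (k1 : δ * κ ≤ ω)
    (k2 : 4 * (3 * β + Cq) * κ < δ * ω) :
    ∃ p : ℂ, DD q β ω κ p = 0 ∧ p.re < 0 ∧ ‖p - I * ω‖ ≤ (3 * β + Cq) / ω * κ ^ 2 ∧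
      ‖p - I * ω‖ ≤ δ * κ / 4 := by
  have hδ := Q.hδ
  have hM : 0 < 3 * β + Cq := by have := Q.hβ; have := Q.hC; linarith
  have hr : 0 < δ * κ := by positivity
  have hball : ∀ z ∈ Metric.closedBall (I * ω : ℂ) (δ * κ), -(2 * δ * κ) ≤ z.re ∧ ω - δ * κ ≤ z.im := by
    intro z hz
    rw [Metric.mem_closedBall, dist_eq_norm] at hz
    have h1 := (abs_le.mp ((Complex.abs_re_le_norm _).trans hz)).1
    have h2 := (abs_le.mp ((Complex.abs_im_le_norm _).trans hz)).1
    simp at h1 h2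
    constructor <;> linarith
  obtain ⟨p, hp, hp0⟩ := exists_zero (DD q β ω κ) (I * ω) (δ * κ)
    (δ * κ * ω - (3 * β + Cq) * κ ^ 2) hr
    (fun z hz => (DD_diff Q hκ z (hball z hz).1).differentiableAt)
    (by
      intro z hz
      have hb := hball z (Metric.sphere_subset_closedBall hz)
      have h1 := DD_near (ω := ω) Q hκ z hb.1
      rw [mem_sphere_iff_norm] at hz
      have h2 : ω ≤ ‖z + I * ω‖ := by
        have := norm_ge_im (z + I * ω)
        simp at this; linarith
      have h3 : δ * κ * ω ≤ ‖(z - I * ω) * (z + I * ω)‖ := by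
        rw [norm_mul, hz]; gcongr
      have h4 := norm_sub_norm_le ((z - I * ω) * (z + I * ω)) (DD q β ω κ z)
      rw [norm_sub_rev] at h4
      linarith)
    (by
      have h1 := DD_near (ω := ω) Q hκ (I * ω) (hball _ (Metric.mem_closedBall_self hr.le)).1
      rw [sub_self, zero_mul, sub_zero] at h1
      refine h1.trans_lt ?_
      have : 4 * (3 * β + Cq) * κ * κ < δ * ω * κ := by gcongr
      nlinarith [mul_pos hM (mul_pos hκ hκ)])
  have hb := hball p hp
  have hn := zero_near Q hω hκ p hb.1 (by linarith) hp0
  refine ⟨p, hp0, ?_, hn, ?_⟩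
  · by_contra! hre
    have hk : (κ : ℂ) ≠ 0 := by exact_mod_cast hκ.ne'
    have := Q.pen (p / κ) (by rw [Complex.div_ofReal_re]; positivity) (ω ^ 2 / κ ^ 2) (by positivity)
    apply this
    have h5 : (p / κ) ^ 2 + 3 * β + q (p / κ) + ((ω ^ 2 / κ ^ 2 : ℝ) : ℂ) = DD q β ω κ p / κ ^ 2 := by
      simp only [DD]; push_cast; field_simp; ring
    rw [h5, hp0, zero_div]
  · refine hn.trans ?_
    rw [div_mul_eq_mul_div, div_le_div_iff₀ hω (by norm_num)]
    have : 4 * (3 * β + Cq) * κ * κ < δ * ω * κ := by gcongr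
    nlinarith

lemma zero_unique_up (Q : QHyp q β δ Cq L) (hω : 0 < ω) (hκ : 0 < κ) (k3 : 2 * L * κ < ω)
    (p : ℂ) (hp : DD q β ω κ p = 0) (hpre : -(2 * δ * κ) ≤ p.re) (hpim : ω / 2 ≤ p.im)
    (l : ℂ) (hl : -(2 * δ * κ) ≤ l.re) (him : 0 ≤ l.im) (h0 : DD q β ω κ l = 0) : l = p := by
  have hk : (κ : ℂ) ≠ 0 := by exact_mod_cast hκ.ne'
  have h1 := Q.lip (l / κ) (p / κ) (re_div hκ hl) (re_div hκ hpre)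
  rw [← sub_div, norm_div, Complex.norm_real, Real.norm_of_nonneg hκ.le] at h1
  have h2 : (l - p) * (l + p) = - (κ ^ 2 * (q (l / κ) - q (p / κ))) := by
    simp only [DD] at hp h0
    linear_combination h0 - hp
  have h3 : ‖l - p‖ * ‖l + p‖ ≤ κ * L * ‖l - p‖ := by
    rw [← norm_mul, h2, norm_neg, norm_mul, norm_pow, Complex.norm_real, Real.norm_of_nonneg hκ.le]
    calc κ ^ 2 * ‖q (l / κ) - q (p / κ)‖ ≤ κ ^ 2 * (L * (‖l - p‖ / κ)) := by gcongr
      _ = _ := by field_simp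
  have h4 : ω / 2 ≤ ‖l + p‖ := by
    have := norm_ge_im (l + p)
    rw [Complex.add_im] at this; linarith
  by_contra hne
  have h5 : 0 < ‖l - p‖ := norm_pos_iff.mpr (sub_ne_zero.mpr hne)
  nlinarith

lemma zero_unique (Q : QHyp q β δ Cq L) (hω : 0 < ω) (hκ : 0 < κ) (k3 : 2 * L * κ < ω)
    (p : ℂ) (hp : DD q β ω κ p = 0) (hpre : -(2 * δ * κ) ≤ p.re) (hpim : ω / 2 ≤ p.im)
    (l : ℂ) (hl : -(2 * δ * κ) ≤ l.re) (h0 : DD q β ω κ l = 0) : l = p ∨ l = starRingEnd ℂ p := by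
  rcases le_total 0 l.im with h | h
  · exact Or.inl (zero_unique_up Q hω hκ k3 p hp hpre hpim l hl h h0)
  · right
    have := zero_unique_up Q hω hκ k3 p hp hpre hpim (starRingEnd ℂ l) (by simpa using hl)
      (by simpa using h) (by rw [DD_conj Q, h0, map_zero])
    rw [← this, Complex.conj_conj]

lemma deriv_near (Q : QHyp q β δ Cq L) (hω : 0 < ω) (hκ : 0 < κ) (k4 : κ ≤ 1)
    (p : ℂ) (hpre : -(2 * δ * κ) ≤ p.re) (hpim : ω / 2 ≤ p.im)
    (hpn : ‖p - I * ω‖ ≤ (3 * β + Cq) / ω * κ ^ 2) :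
    ‖2 * p + κ * deriv q (p / κ) - 2 * I * ω‖ ≤ (2 * (3 * β + Cq) / ω + 4 * L / ω ^ 2) * κ ^ 2 := by
  have h1 := Q.bd' (p / κ) (re_div hκ hpre)
  rw [norm_div, Complex.norm_real, Real.norm_of_nonneg hκ.le] at h1
  have hL := Q.hL
  have h2 : ω / 2 ≤ ‖p‖ := hpim.trans (norm_ge_im p)
  have h3 : ‖deriv q (p / κ)‖ ≤ 4 * L / ω ^ 2 * κ ^ 2 := by
    refine h1.trans ?_
    calc L / (1 + (‖p‖ / κ) ^ 2) ≤ L / (((ω / 2) / κ) ^ 2) := by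
          gcongr
          have : (ω / 2 / κ) ^ 2 ≤ (‖p‖ / κ) ^ 2 := by gcongr
          linarith
      _ = _ := by field_simp; norm_num
  have e : 2 * p + κ * deriv q (p / κ) - 2 * I * ω = 2 * (p - I * ω) + κ * deriv q (p / κ) := by ring
  rw [e]
  refine (norm_add_le _ _).trans ?_
  rw [norm_mul, norm_mul, Complex.norm_real, Real.norm_of_nonneg hκ.le, Complex.norm_two]
  have h4 : κ * ‖deriv q (p / κ)‖ ≤ 1 * (4 * L / ω ^ 2 * κ ^ 2) := by gcongr
  have : (2 * (3 * β + Cq) / ω + 4 * L / ω ^ 2) * κ ^ 2 =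
    2 * ((3 * β + Cq) / ω * κ ^ 2) + 1 * (4 * L / ω ^ 2 * κ ^ 2) := by ring
  rw [this]
  gcongr

lemma J_near (hω : 0 < ω) (d : ℂ) (E : ℝ) (hE : E ≤ ω) (hd : ‖d - 2 * I * ω‖ ≤ E) :
    d ≠ 0 ∧ ‖-(ω : ℂ) ^ 2 / d - I * ω / 2‖ ≤ E / 2 := by
  have hw : (ω : ℂ) ≠ 0 := by exact_mod_cast hω.ne'
  have h1 : ‖(2 * I * ω : ℂ)‖ = 2 * ω := by simp [abs_of_pos hω]
  have h2 : ω ≤ ‖d‖ := by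
    have := norm_sub_norm_le (2 * I * ω : ℂ) d
    rw [norm_sub_rev, h1] at this
    linarith
  have hd0 : d ≠ 0 := norm_pos_iff.mp (hω.trans_le h2)
  refine ⟨hd0, ?_⟩
  have e : -(ω : ℂ) ^ 2 / d - I * ω / 2 = ω ^ 2 * (d - 2 * I * ω) / (d * (2 * I * ω)) := by
    field_simp
    ring_nf
    simp only [I_sq]; ring
  rw [e, norm_div, norm_mul, norm_mul, h1, norm_pow, Complex.norm_real, Real.norm_of_nonneg hω.le]
  have hE0 : 0 ≤ E := (norm_nonneg _).trans hd
  calc ω ^ 2 * ‖d - 2 * I * ω‖ / (‖d‖ * (2 * ω)) ≤ ω ^ 2 * E / (ω * (2 * ω)) := by gcongr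
    _ = E / 2 := by field_simp

end

open MeasureTheory Complex

lemma three_inv (ω X Y Z : ℝ) (hω : 0 < ω) (hX : 0 < X) (hY : 0 < Y) (hZ : 0 < Z)
    (h : (ω ^ 2 / 4 ≤ X ∧ ω ^ 2 / 4 ≤ Y) ∨ (ω ^ 2 / 4 ≤ X ∧ ω ^ 2 / 4 ≤ Z) ∨
      (ω ^ 2 / 4 ≤ Y ∧ ω ^ 2 / 4 ≤ Z)) :
    1 / (X * (Y * Z)) ≤ 16 / ω ^ 4 * (1 / X + 1 / Y + 1 / Z) := by
  have key : ∀ U V W : ℝ, 0 < U → 0 < V → 0 < W → ω ^ 2 / 4 ≤ U → ω ^ 2 / 4 ≤ V →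
      1 / (U * (V * W)) ≤ 16 / ω ^ 4 * (1 / W) := by
    intro U V W hU hV hW h1 h2
    calc 1 / (U * (V * W)) ≤ 1 / (ω ^ 2 / 4 * (ω ^ 2 / 4 * W)) := by gcongr
      _ = _ := by field_simp; norm_num
  have pX : 0 < 1 / X := by positivity
  have pY : 0 < 1 / Y := by positivity
  have pZ : 0 < 1 / Z := by positivity
  have p16 : 0 < 16 / ω ^ 4 := by positivity
  rcases h with ⟨h1, h2⟩ | ⟨h1, h2⟩ | ⟨h1, h2⟩
  · refine (key X Y Z hX hY hZ h1 h2).trans ?_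
    gcongr; linarith
  · have := key X Z Y hX hZ hY h1 h2
    rw [mul_comm Z Y] at this
    refine this.trans ?_
    gcongr; linarith
  · have := key Y Z X hY hZ hX h1 h2
    have e : X * (Y * Z) = Y * (Z * X) := by ring
    rw [e]
    refine this.trans ?_
    gcongr; linarith

section
variable {q : ℂ → ℂ} {β δ Cq L ω κ : ℝ}

set_option maxHeartbeats 1000000 in
lemma DD_tail (Q : QHyp q β δ Cq L) (hω : 0 < ω) (hκ : 0 < κ)
    (k2 : 4 * (3 * β + Cq) * κ < δ * ω) (Ω : ℝ) (hΩ0 : 0 < Ω)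
    (hΩ : Ω ^ 2 = ω ^ 2 + 3 * β * κ ^ 2) (y : ℝ) :
    let m : ℂ := ((-(δ * κ / 2) : ℝ) : ℂ) + y * I
    DD q β ω κ m ≠ 0 ∧ m ^ 2 + (Ω : ℂ) ^ 2 ≠ 0 ∧
    ‖(ω : ℂ) ^ 2 * (κ ^ 2 * q (m / κ)) / (DD q β ω κ m * (m ^ 2 + Ω ^ 2))‖ ≤
      32 * Cq * κ ^ 4 / ω ^ 2 * (1 / (κ ^ 2 + (y - 0) ^ 2) + 1 / ((δ * κ / 2) ^ 2 + (y - Ω) ^ 2)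
        + 1 / ((δ * κ / 2) ^ 2 + (y - -Ω) ^ 2)) := by
  intro m
  have hδ := Q.hδ
  have hC := Q.hC
  have hβ := Q.hβ
  have hωΩ : ω ≤ Ω := by
    by_contra! h
    have : 0 < 3 * β * κ ^ 2 := by positivity
    nlinarith
  set b := δ * κ / 2 with hb
  have hb0 : 0 < b := by positivity
  set X := κ ^ 2 + (y - 0) ^ 2 with hX
  set Y := b ^ 2 + (y - Ω) ^ 2 with hY
  set Z := b ^ 2 + (y - -Ω) ^ 2 with hZ
  have pX : 0 < X := by positivity
  have pY : 0 < Y := by positivity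
  have pZ : 0 < Z := by positivity
  have hmre : m.re = -b := by simp [m, hb]
  have hmim : m.im = y := by simp [m]
  have hre : -(2 * δ) ≤ (m / κ).re := re_div hκ (by rw [hmre, hb]; nlinarith [mul_pos hδ hκ])
  -- norm of D0
  have n0 : ‖m ^ 2 + (Ω : ℂ) ^ 2‖ ^ 2 = Y * Z := by
    rw [← Complex.normSq_eq_norm_sq, Complex.normSq_apply]
    have e1 : (m ^ 2 + (Ω : ℂ) ^ 2).re = b ^ 2 - y ^ 2 + Ω ^ 2 := by
      rw [← Complex.ofReal_pow, Complex.add_re, Complex.ofReal_re, pow_two, Complex.mul_re, hmre, hmim]; ring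
    have e2 : (m ^ 2 + (Ω : ℂ) ^ 2).im = -2 * b * y := by
      rw [← Complex.ofReal_pow, Complex.add_im, Complex.ofReal_im, pow_two, Complex.mul_im, hmre, hmim]; ring
    rw [e1, e2, hY, hZ]; ring
  have nb : b * ω ≤ ‖m ^ 2 + (Ω : ℂ) ^ 2‖ := by
    refine le_of_sq_le_sq ?_ (norm_nonneg _)
    rw [n0, mul_pow]
    rcases le_total 0 y with h | h
    · have : b ^ 2 ≤ Y := by rw [hY]; nlinarith [sq_nonneg (y - Ω)]
      have : ω ^ 2 ≤ Z := by rw [hZ]; nlinarith [sq_nonneg b]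
      gcongr
    · have : b ^ 2 ≤ Z := by rw [hZ]; nlinarith [sq_nonneg (y - -Ω)]
      have : ω ^ 2 ≤ Y := by rw [hY]; nlinarith [sq_nonneg b]
      rw [mul_comm Y Z]
      gcongr
  have eD : DD q β ω κ m = (m ^ 2 + (Ω : ℂ) ^ 2) + κ ^ 2 * q (m / κ) := by
    have : (Ω : ℂ) ^ 2 = ω ^ 2 + 3 * β * κ ^ 2 := by exact_mod_cast hΩ
    rw [this, DD]; ring
  have nq : ‖(κ : ℂ) ^ 2 * q (m / κ)‖ = κ ^ 2 * ‖q (m / κ)‖ := by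
    rw [norm_mul, norm_pow, Complex.norm_real, Real.norm_of_nonneg hκ.le]
  have hq1 : κ ^ 2 * ‖q (m / κ)‖ ≤ κ ^ 2 * Cq := by
    gcongr; exact Q.bd1 _ hre
  have hsm : κ ^ 2 * Cq ≤ b * ω / 2 := by
    have h1 : 4 * (3 * β + Cq) * κ * κ < δ * ω * κ := by gcongr
    have h2 : 0 < β * κ * κ := by positivity
    rw [hb]; nlinarith
  have nD : ‖m ^ 2 + (Ω : ℂ) ^ 2‖ / 2 ≤ ‖DD q β ω κ m‖ := by
    rw [eD]
    have := norm_sub_le ((m ^ 2 + (Ω : ℂ) ^ 2) + κ ^ 2 * q (m / κ)) (κ ^ 2 * q (m / κ))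
    rw [add_sub_cancel_right, nq] at this
    linarith
  have p0 : 0 < ‖m ^ 2 + (Ω : ℂ) ^ 2‖ := lt_of_lt_of_le (by positivity) nb
  refine ⟨norm_pos_iff.mp (by linarith), norm_pos_iff.mp p0, ?_⟩
  have hq2 : ‖q (m / κ)‖ ≤ Cq * κ ^ 2 / X := by
    refine (Q.bd _ hre).trans ?_
    rw [norm_div, Complex.norm_real, Real.norm_of_nonneg hκ.le]
    have : y ^ 2 ≤ ‖m‖ ^ 2 := by
      rw [← sq_abs y, ← hmim]; gcongr; exact Complex.abs_im_le_norm m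
    have h1 : X / κ ^ 2 ≤ 1 + (‖m‖ / κ) ^ 2 := by
      rw [div_le_iff₀ (by positivity)]
      have : (1 + (‖m‖ / κ) ^ 2) * κ ^ 2 = κ ^ 2 + ‖m‖ ^ 2 := by field_simp
      rw [this, hX, sub_zero]; linarith
    calc Cq / (1 + (‖m‖ / κ) ^ 2) ≤ Cq / (X / κ ^ 2) := by gcongr
      _ = _ := by field_simp
  rw [norm_div, norm_mul, norm_mul (DD q β ω κ m), nq, norm_pow, Complex.norm_real, Real.norm_of_nonneg hω.le]
  have h3 := three_inv ω X Y Z hω pX pY pZ (by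
    have hh : ω / 2 ≤ Ω / 2 := by linarith
    have sq : ∀ x : ℝ, ω / 2 ≤ |x| → ω ^ 2 / 4 ≤ x ^ 2 := by
      intro x hx
      rw [← sq_abs x]
      have : (ω / 2) ^ 2 ≤ |x| ^ 2 := by gcongr
      linarith [this, (by ring : (ω / 2) ^ 2 = ω ^ 2 / 4)]
    by_cases c1 : ω / 2 ≤ y
    · right; left
      have i1 := sq (y - 0) (by rw [sub_zero]; exact c1.trans (le_abs_self _))
      have i2 := sq (y - -Ω) (le_trans (by linarith) (le_abs_self _))
      constructor
      · exact le_add_of_nonneg_of_le (sq_nonneg _) i1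
      · exact le_add_of_nonneg_of_le (sq_nonneg _) i2
    · by_cases c2 : ω / 2 ≤ -y
      · left
        have i1 := sq (y - 0) (by rw [sub_zero]; exact c2.trans (neg_le_abs _))
        have i2 := sq (y - Ω) (le_trans (by linarith) (neg_le_abs _))
        constructor
        · exact le_add_of_nonneg_of_le (sq_nonneg _) i1
        · exact le_add_of_nonneg_of_le (sq_nonneg _) i2
      · right; right
        have i1 := sq (y - Ω) (le_trans (by linarith) (neg_le_abs _))
        have i2 := sq (y - -Ω) (le_trans (by linarith) (le_abs_self _))
        constructor
        · exact le_add_of_nonneg_of_le (sq_nonneg _) i1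
        · exact le_add_of_nonneg_of_le (sq_nonneg _) i2)
  calc ω ^ 2 * (κ ^ 2 * ‖q (m / κ)‖) / (‖DD q β ω κ m‖ * ‖m ^ 2 + (Ω : ℂ) ^ 2‖)
      ≤ ω ^ 2 * (κ ^ 2 * (Cq * κ ^ 2 / X)) /
        (‖m ^ 2 + (Ω : ℂ) ^ 2‖ / 2 * ‖m ^ 2 + (Ω : ℂ) ^ 2‖) := by gcongr
    _ = ω ^ 2 * (κ ^ 2 * (Cq * κ ^ 2 / X)) / (Y * Z / 2) := by rw [← n0]; ring
    _ = 2 * ω ^ 2 * Cq * κ ^ 4 * (1 / (X * (Y * Z))) := by field_simp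
    _ ≤ 2 * ω ^ 2 * Cq * κ ^ 4 * (16 / ω ^ 4 * (1 / X + 1 / Y + 1 / Z)) := by gcongr
    _ = _ := by field_simp; ring

end

lemma R_construct (T : ℝ → ℂ) (hT : Integrable T) (b : ℝ) :
    ∃ R : ℝ → ℂ, Continuous R ∧ (∀ t, ‖R t‖ ≤ (1 / (2 * Real.pi)) * (∫ y, ‖T y‖) * Real.exp (-b * t)) ∧
      ∀ l : ℂ, -b < l.re → ∫ t in Set.Ioi (0 : ℝ), R t * cexp (-l * t) =
        (1 / (2 * Real.pi)) * ∫ y : ℝ, T y / (l - (((-b : ℝ) : ℂ) + y * I)) := by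
  set R : ℝ → ℂ := fun t => (1 / (2 * Real.pi)) * ∫ y : ℝ, cexp ((((-b : ℝ) : ℂ) + y * I) * t) * T y with hR
  have hn : ∀ t y : ℝ, ‖cexp ((((-b : ℝ) : ℂ) + y * I) * t) * T y‖ = Real.exp (-b * t) * ‖T y‖ := by
    intro t y
    rw [norm_mul, Complex.norm_exp]
    simp
  have hpi : ‖(1 / (2 * Real.pi) : ℂ)‖ = 1 / (2 * Real.pi) := by
    simp [abs_of_pos Real.pi_pos]
  refine ⟨R, ?_, ?_, ?_⟩
  · refine continuous_const.mul ?_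
    rw [continuous_iff_continuousAt]
    intro t0
    refine continuousAt_of_dominated (bound := fun y => Real.exp (|b| * (|t0| + 1)) * ‖T y‖) ?_ ?_ ?_ ?_
    · refine Filter.Eventually.of_forall fun t => ?_
      exact (Continuous.aestronglyMeasurable (by fun_prop)).mul hT.1
    · filter_upwards [Metric.ball_mem_nhds t0 one_pos] with t ht
      refine Filter.Eventually.of_forall fun y => ?_
      rw [hn]
      refine mul_le_mul_of_nonneg_right (Real.exp_le_exp.mpr ?_) (norm_nonneg _)
      rw [Metric.mem_ball, Real.dist_eq] at ht
      have : |t| ≤ |t0| + 1 := by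
        have := abs_sub_abs_le_abs_sub t t0
        linarith
      calc -b * t ≤ |-b * t| := le_abs_self _
        _ = |b| * |t| := by rw [abs_mul, abs_neg]
        _ ≤ _ := by gcongr
    · exact hT.norm.const_mul _
    · refine Filter.Eventually.of_forall fun y => ?_
      fun_prop
  · intro t
    rw [hR]
    simp only
    rw [norm_mul, hpi, mul_assoc]
    gcongr
    refine (norm_integral_le_integral_norm _).trans (le_of_eq ?_)
    simp_rw [hn]
    rw [integral_const_mul, mul_comm]
  · intro l hl
    simp only [hR]
    simp_rw [mul_assoc]
    rw [integral_const_mul]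
    congr 1
    have hintg : Integrable (Function.uncurry fun (t : ℝ) (y : ℝ) =>
        cexp ((((-b : ℝ) : ℂ) + y * I) * t) * T y * cexp (-l * t))
        ((volume.restrict (Set.Ioi 0)).prod volume) := by
      have h1 : Integrable (fun t : ℝ => cexp (-(l + b) * t)) (volume.restrict (Set.Ioi 0)) :=
        integrableOn_exp_mul_complex_Ioi (by simp; linarith) 0
      have h2 := h1.mul_prod hT
      have hm : AEStronglyMeasurable (fun z : ℝ × ℝ => cexp (I * z.1 * z.2))
          ((volume.restrict (Set.Ioi 0)).prod volume) :=
        Continuous.aestronglyMeasurable (by fun_prop)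
      have h3 := h2.bdd_mul (c := 1) hm (Filter.Eventually.of_forall fun z => by
        rw [Complex.norm_exp]; simp)
      refine h3.congr (Filter.Eventually.of_forall fun z => ?_)
      simp only [Function.uncurry]
      have e : cexp ((((-b : ℝ) : ℂ) + z.2 * I) * z.1) * T z.2 * cexp (-l * z.1) =
        (cexp ((((-b : ℝ) : ℂ) + z.2 * I) * z.1) * cexp (-l * z.1)) * T z.2 := by ring
      rw [e, ← mul_assoc, ← Complex.exp_add, ← Complex.exp_add]
      congr 2
      push_cast; ring
    have hsw := integral_integral_swap hintg
    have hl1 : ∀ t : ℝ, (∫ y : ℝ, cexp ((((-b : ℝ) : ℂ) + y * I) * t) * T y * cexp (-l * t)) =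
        (∫ y : ℝ, cexp ((((-b : ℝ) : ℂ) + y * I) * t) * T y) * cexp (-l * t) := fun t =>
      integral_mul_const _ _
    simp_rw [hl1] at hsw
    rw [hsw]
    refine integral_congr_ae (Filter.Eventually.of_forall fun y => ?_)
    simp only
    have e : ∀ t : ℝ, cexp ((((-b : ℝ) : ℂ) + y * I) * t) * T y * cexp (-l * t) =
        T y * cexp (((((-b : ℝ) : ℂ) + y * I) - l) * t) := by
      intro t
      have : ((((-b : ℝ) : ℂ) + y * I) - l) * t = (((-b : ℝ) : ℂ) + y * I) * t + -l * t := by ring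
      rw [this, Complex.exp_add]; ring
    simp_rw [e]
    rw [integral_const_mul, integral_exp_mul_complex_Ioi (by simp; linarith) 0]
    simp only [Complex.ofReal_zero, mul_zero, Complex.exp_zero]
    rw [← neg_sub l, neg_div_neg_eq, mul_one_div]

open MeasureTheory Complex

section
variable {q : ℂ → ℂ} {β δ Cq L ω κ : ℝ}

lemma F_decay (Q : QHyp q β δ Cq L) (hκ : 0 < κ) (p c J J' : ℂ) (F : ℂ → ℂ)
    (hF : ∀ z : ℂ, -(δ * κ) < z.re → z ≠ p → z ≠ c →
      F z = -(ω : ℂ) ^ 2 / DD q β ω κ z - J / (z - p) - J' / (z - c)) :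
    ∃ A C : ℝ, ∀ z : ℂ, -(δ * κ / 2) ≤ z.re → A ≤ ‖z‖ → ‖F z‖ ≤ C / ‖z‖ := by
  have hM : 0 < 3 * β + Cq := by have := Q.hβ; have := Q.hC; linarith
  have hδκ : 0 < δ * κ := mul_pos Q.hδ hκ
  refine ⟨2 * ω ^ 2 + 2 * ((3 * β + Cq) * κ ^ 2) + 2 * ‖p‖ + 2 * ‖c‖ + 1,
    2 * ω ^ 2 + 2 * ‖J‖ + 2 * ‖J'‖, fun z hz hA => ?_⟩
  have np := norm_nonneg p
  have nc := norm_nonneg c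
  have mk : 0 < (3 * β + Cq) * κ ^ 2 := by positivity
  have w2 := sq_nonneg ω
  have hz1 : 1 ≤ ‖z‖ := by linarith
  have hzp : z ≠ p := by rintro rfl; linarith
  have hzc : z ≠ c := by rintro rfl; linarith
  rw [hF z (by linarith) hzp hzc]
  have b1 := norm_sub_half z p (by linarith)
  have b2 := norm_sub_half z c (by linarith)
  have b3 : ‖z‖ / 2 ≤ ‖DD q β ω κ z‖ := by
    have h1 := DD_near (ω := ω) Q hκ z (by linarith)
    have e : (z - I * ω) * (z + I * ω) = z ^ 2 + (ω : ℂ) ^ 2 := by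
      linear_combination -(ω : ℂ) ^ 2 * Complex.I_sq
    rw [e] at h1
    have h2 := norm_sub_norm_le (z ^ 2 + (ω : ℂ) ^ 2) (DD q β ω κ z)
    rw [norm_sub_rev] at h2
    have h3 := norm_sub_le (z ^ 2 + (ω : ℂ) ^ 2) ((ω : ℂ) ^ 2)
    rw [add_sub_cancel_right, norm_pow, norm_pow, Complex.norm_real, Real.norm_eq_abs, sq_abs] at h3
    nlinarith
  refine (norm_sub_le _ _).trans ((add_le_add_left (norm_sub_le _ _) _).trans ?_)
  rw [norm_div, norm_div, norm_div, norm_neg, norm_pow, Complex.norm_real, Real.norm_eq_abs, sq_abs]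
  have hz0 : 0 < ‖z‖ := by linarith
  calc ω ^ 2 / ‖DD q β ω κ z‖ + ‖J‖ / ‖z - p‖ + ‖J'‖ / ‖z - c‖
      ≤ ω ^ 2 / (‖z‖ / 2) + ‖J‖ / (‖z‖ / 2) + ‖J'‖ / (‖z‖ / 2) := by gcongr
    _ = _ := by field_simp

set_option maxHeartbeats 1000000 in
lemma spectral (Q : QHyp q β δ Cq L) (hω : 0 < ω) (hκ : 0 < κ) (k1 : δ * κ ≤ ω)
    (k2 : 4 * (3 * β + Cq) * κ < δ * ω) (k3 : 2 * L * κ < ω) (k4 : κ ≤ 1)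
    (k5 : (2 * (3 * β + Cq) / ω + 4 * L / ω ^ 2) * κ ≤ ω) :
    ∃ (p J : ℂ) (R : ℝ → ℂ), p.re < 0 ∧ ‖p - I * ω‖ ≤ (3 * β + Cq) / ω * κ ^ 2 ∧
      ‖J - I * ω / 2‖ ≤ (2 * (3 * β + Cq) / ω + 4 * L / ω ^ 2) / 2 * κ ^ 2 ∧
      Continuous R ∧
      (∀ t, ‖R t‖ ≤ 16 * Cq * (1 + 4 / δ) / ω ^ 2 * κ ^ 3 * Real.exp (-(δ / 2) * κ * t)) ∧
      ∀ l : ℂ, 0 < l.re → ∫ t in Set.Ioi (0 : ℝ), R t * cexp (-l * t) =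
        -(ω : ℂ) ^ 2 / DD q β ω κ l - J / (l - p) - starRingEnd ℂ J / (l - starRingEnd ℂ p) := by
  have hδ := Q.hδ
  have hC := Q.hC
  have hβ := Q.hβ
  have hL := Q.hL
  have hδκ : 0 < δ * κ := mul_pos hδ hκ
  obtain ⟨p, hp0, hpre, hpn, hpn'⟩ := pole_exists Q hω hκ k1 k2
  have hpre2 : -(δ * κ / 4) ≤ p.re := by
    have := (abs_le.mp ((Complex.abs_re_le_norm _).trans hpn')).1
    simp at this; linarith
  have hpim : ω / 2 ≤ p.im := by
    have := (abs_le.mp ((Complex.abs_im_le_norm _).trans hpn')).1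
    simp at this; linarith
  have hpre3 : -(2 * δ * κ) ≤ p.re := by linarith
  set c := starRingEnd ℂ p with hc
  have hcre : c.re = p.re := by simp [hc]
  have hpc : p ≠ c := by
    intro h
    have := congrArg Complex.im h
    simp [hc] at this; linarith
  set d := 2 * p + κ * deriv q (p / κ) with hd
  set E := 2 * (3 * β + Cq) / ω + 4 * L / ω ^ 2 with hE
  have hE0 : 0 < E := by positivity
  have dn := deriv_near Q hω hκ k4 p hpre3 hpim hpn
  obtain ⟨hd0, hJ⟩ := J_near hω d (E * κ ^ 2) (by
    have : E * κ * κ ≤ ω * 1 := by gcongr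
    linarith) dn
  have hder : HasDerivAt (DD q β ω κ) d p := DD_diff Q hκ p hpre3
  have hderc : HasDerivAt (DD q β ω κ) (starRingEnd ℂ d) c := by
    have h1 := hder.conj_conj
    have h2 : (starRingEnd ℂ ∘ DD q β ω κ ∘ starRingEnd ℂ) = DD q β ω κ := by
      ext z
      simp only [Function.comp]
      rw [DD_conj Q, Complex.conj_conj]
    rwa [h2] at h1
  have hU : IsOpen {z : ℂ | -(δ * κ) < z.re} := isOpen_lt continuous_const Complex.continuous_re
  obtain ⟨F, hFd, hF⟩ := partial_fractions (DD q β ω κ) {z : ℂ | -(δ * κ) < z.re} hU p c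
    (by show -(δ * κ) < p.re; linarith) (by show -(δ * κ) < c.re; rw [hcre]; linarith) hpc
    (fun z hz => by
      have hz' : -(δ * κ) < z.re := hz
      exact (DD_diff Q hκ z (by linarith)).differentiableAt.differentiableWithinAt)
    hp0 (by rw [hc, DD_conj Q, hp0, map_zero])
    (fun z hz h0 => by
      have hz' : -(δ * κ) < z.re := hz
      exact zero_unique Q hω hκ k3 p hp0 hpre3 hpim z (by linarith) h0)
    (by rw [hder.deriv]; exact hd0)
    (by rw [hderc.deriv]; exact (map_ne_zero _).mpr hd0)
  rw [hder.deriv, hderc.deriv] at hF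
  set J : ℂ := -(ω : ℂ) ^ 2 / d with hJdef
  have hJc : starRingEnd ℂ J = -(ω : ℂ) ^ 2 / starRingEnd ℂ d := by
    simp [hJdef]
  set F0 : ℂ → ℂ := fun z => -(ω : ℂ) ^ 2 * F z with hF0
  have hF0e : ∀ z : ℂ, -(δ * κ) < z.re → z ≠ p → z ≠ c →
      F0 z = -(ω : ℂ) ^ 2 / DD q β ω κ z - J / (z - p) - starRingEnd ℂ J / (z - c) := by
    intro z hz h1 h2
    simp only [hF0]
    rw [hF z hz h1 h2, hJc, hJdef]
    ring
  have hF0d : DifferentiableOn ℂ F0 {z : ℂ | -(δ * κ) < z.re} := hFd.const_mul _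
  obtain ⟨A, CF, hdec⟩ := F_decay Q hκ p c J (starRingEnd ℂ J) F0 hF0e
  set Ω := Real.sqrt (ω ^ 2 + 3 * β * κ ^ 2) with hΩ
  have hΩ0 : 0 < Ω := Real.sqrt_pos.mpr (by positivity)
  have hΩ2 : Ω ^ 2 = ω ^ 2 + 3 * β * κ ^ 2 := Real.sq_sqrt (by positivity)
  have hΩ2c : (Ω : ℂ) ^ 2 = ω ^ 2 + 3 * β * κ ^ 2 := by exact_mod_cast hΩ2
  have hΩc : (Ω : ℂ) ≠ 0 := by exact_mod_cast hΩ0.ne'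
  set b := δ * κ / 2 with hb
  have hb0 : 0 < b := by positivity
  set m : ℝ → ℂ := fun y => ((-b : ℝ) : ℂ) + y * I with hm
  set T : ℝ → ℂ := fun y => (ω : ℂ) ^ 2 * (κ ^ 2 * q (m y / κ)) /
    (DD q β ω κ (m y) * ((m y) ^ 2 + Ω ^ 2)) with hT
  have htail := fun y : ℝ => DD_tail Q hω hκ k2 Ω hΩ0 hΩ2 y
  have hmre : ∀ y, (m y).re = -b := fun y => by simp [hm]
  have hmcont : Continuous m := by fun_prop
  have hqc : Continuous fun y => q (m y / κ) := by
    rw [continuous_iff_continuousAt]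
    intro y
    have h1 : ContinuousAt q (m y / κ) :=
      (Q.diff _ (re_div hκ (by rw [hmre, hb]; linarith))).continuousAt
    exact ContinuousAt.comp (f := fun y => m y / (κ : ℂ)) h1 (by fun_prop)
  have hTc : Continuous T := by
    refine Continuous.div (continuous_const.mul (continuous_const.mul hqc)) ?_ (fun y => mul_ne_zero (htail y).1 (htail y).2.1)
    simp only [DD]
    exact (((hmcont.pow 2).add continuous_const).add
      (continuous_const.mul (continuous_const.add hqc))).mul ((hmcont.pow 2).add continuous_const)
  obtain ⟨l1, v1⟩ := lorentz κ 0 hκ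
  obtain ⟨l2, v2⟩ := lorentz b Ω hb0
  obtain ⟨l3, v3⟩ := lorentz b (-Ω) hb0
  have l12 := l1.add l2
  have l123 : Integrable (fun y : ℝ => (1 / (κ ^ 2 + (y - 0) ^ 2) + 1 / (b ^ 2 + (y - Ω) ^ 2)
        + 1 / (b ^ 2 + (y - -Ω) ^ 2))) := l12.add l3
  have v123 : ∫ y : ℝ, (1 / (κ ^ 2 + (y - 0) ^ 2) + 1 / (b ^ 2 + (y - Ω) ^ 2)
        + 1 / (b ^ 2 + (y - -Ω) ^ 2)) = Real.pi / κ + Real.pi / b + Real.pi / b := by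
    rw [integral_add (f := fun y : ℝ => 1 / (κ ^ 2 + (y - 0) ^ 2) + 1 / (b ^ 2 + (y - Ω) ^ 2)) l12 l3,
      integral_add l1 l2, v1, v2, v3]
  have hTn : ∀ y, ‖T y‖ ≤ 32 * Cq * κ ^ 4 / ω ^ 2 * (1 / (κ ^ 2 + (y - 0) ^ 2) +
      1 / (b ^ 2 + (y - Ω) ^ 2) + 1 / (b ^ 2 + (y - -Ω) ^ 2)) := fun y => (htail y).2.2
  have hTi : Integrable T := (l123.const_mul _).mono' hTc.aestronglyMeasurable
    (Filter.Eventually.of_forall hTn)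
  have hTb : ∫ y, ‖T y‖ ≤ 32 * Cq * κ ^ 4 / ω ^ 2 * (Real.pi / κ + Real.pi / b + Real.pi / b) := by
    rw [← v123, ← integral_const_mul]
    exact integral_mono hTi.norm (l123.const_mul _) hTn
  obtain ⟨R, hRc, hRb, hRl⟩ := R_construct T hTi b
  refine ⟨p, J, R, hpre, hpn, ?_, hRc, ?_, ?_⟩
  · refine hJ.trans (le_of_eq ?_); ring
  · intro t
    refine (hRb t).trans ?_
    have e : -b * t = -(δ / 2) * κ * t := by rw [hb]; ring
    rw [e]
    refine mul_le_mul_of_nonneg_right ?_ (Real.exp_pos _).le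
    calc 1 / (2 * Real.pi) * ∫ y, ‖T y‖ ≤ 1 / (2 * Real.pi) *
          (32 * Cq * κ ^ 4 / ω ^ 2 * (Real.pi / κ + Real.pi / b + Real.pi / b)) := by gcongr
      _ = _ := by
        rw [hb]
        have := Real.pi_pos.ne'
        field_simp
        ring
  · intro l hl
    rw [hRl l (by linarith)]
    have hlp : l ≠ p := by rintro rfl; linarith
    have hlc : l ≠ c := by rintro rfl; linarith
    rw [← hF0e l (by linarith) hlp hlc]
    have hx : -(δ * κ) < -b := by rw [hb]; linarith
    obtain ⟨i0, w0⟩ := halfplane_cauchy F0 (-b) (-(δ * κ)) A CF hx hF0d hdec l (by linarith)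
    obtain ⟨i1, w1⟩ := two_poles (-b) l p (by linarith) (by rw [hb]; linarith)
    obtain ⟨i2, w2⟩ := two_poles (-b) l c (by linarith) (by rw [hb, hcre]; linarith)
    obtain ⟨i3, w3⟩ := two_poles (-b) l (I * Ω) (by linarith) (by simp; linarith)
    obtain ⟨i4, w4⟩ := two_poles (-b) l (-(I * Ω)) (by linarith) (by simp; linarith)
    have hTe : ∀ y : ℝ, T y / (l - (((-b : ℝ) : ℂ) + y * I)) =
        F0 (((-b : ℝ) : ℂ) + y * I) / (l - (((-b : ℝ) : ℂ) + y * I)) +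
        (J * (1 / ((((-b : ℝ) : ℂ) + y * I) - p) / (l - (((-b : ℝ) : ℂ) + y * I))) +
        (starRingEnd ℂ J * (1 / ((((-b : ℝ) : ℂ) + y * I) - c) / (l - (((-b : ℝ) : ℂ) + y * I))) +
        ((ω : ℂ) ^ 2 / (2 * I * Ω) * (1 / ((((-b : ℝ) : ℂ) + y * I) - I * Ω) / (l - (((-b : ℝ) : ℂ) + y * I))) +
        (-((ω : ℂ) ^ 2 / (2 * I * Ω))) * (1 / ((((-b : ℝ) : ℂ) + y * I) - -(I * Ω)) / (l - (((-b : ℝ) : ℂ) + y * I)))))) := by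
      intro y
      have hT' : T y = F0 (m y) + J * (1 / (m y - p)) + starRingEnd ℂ J * (1 / (m y - c)) +
          (ω : ℂ) ^ 2 / (2 * I * Ω) * (1 / (m y - I * Ω)) +
          (-((ω : ℂ) ^ 2 / (2 * I * Ω))) * (1 / (m y - -(I * Ω))) := by
        have n1 : m y ≠ p := by
          intro h; have := hmre y; rw [h] at this; rw [hb] at this; linarith
        have n2 : m y ≠ c := by
          intro h; have := hmre y; rw [h, hcre] at this; rw [hb] at this; linarith
        rw [hF0e (m y) (by rw [hmre]; exact hx) n1 n2]
        have n3 : DD q β ω κ (m y) ≠ 0 := (htail y).1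
        have n4 : (m y) ^ 2 + (Ω : ℂ) ^ 2 ≠ 0 := (htail y).2.1
        have f0 : (m y - I * Ω) * (m y - -(I * Ω)) = (m y) ^ 2 + (Ω : ℂ) ^ 2 := by
          linear_combination -(Ω : ℂ) ^ 2 * Complex.I_sq
        have n5 : m y - I * Ω ≠ 0 := by intro h; rw [h, zero_mul] at f0; exact n4 f0.symm
        have n6 : m y - -(I * Ω) ≠ 0 := by intro h; rw [h, mul_zero] at f0; exact n4 f0.symm
        have f1 : (ω : ℂ) ^ 2 / (2 * I * Ω) * (1 / (m y - I * Ω)) +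
          (-((ω : ℂ) ^ 2 / (2 * I * Ω))) * (1 / (m y - -(I * Ω))) =
            (ω : ℂ) ^ 2 / ((m y) ^ 2 + (Ω : ℂ) ^ 2) := by
          rw [← f0]
          have := Complex.I_ne_zero
          field_simp
          ring
        have f2 : DD q β ω κ (m y) = ((m y) ^ 2 + (Ω : ℂ) ^ 2) + κ ^ 2 * q (m y / κ) := by
          rw [hΩ2c, DD]; ring
        have f3 : T y = -(ω : ℂ) ^ 2 / DD q β ω κ (m y) + (ω : ℂ) ^ 2 / ((m y) ^ 2 + (Ω : ℂ) ^ 2) := by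
          have f4 : (κ : ℂ) ^ 2 * q (m y / κ) = DD q β ω κ (m y) - ((m y) ^ 2 + (Ω : ℂ) ^ 2) := by
            rw [f2]; ring
          simp only [hT]
          rw [f4]
          field_simp
          ring
        rw [f3, add_assoc, f1]
        ring
      rw [hT']
      simp only [hm]
      ring
    simp_rw [hTe]
    have j1 := i1.const_mul J
    have j2 := i2.const_mul (starRingEnd ℂ J)
    have j3 := i3.const_mul ((ω : ℂ) ^ 2 / (2 * I * Ω))
    have j4 := i4.const_mul (-((ω : ℂ) ^ 2 / (2 * I * Ω)))
    rw [integral_add i0, integral_add j1, integral_add j2, integral_add j3 j4, integral_const_mul,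
      integral_const_mul, integral_const_mul, integral_const_mul, w0, w1, w2, w3, w4]
    · have : (Real.pi : ℂ) ≠ 0 := by exact_mod_cast Real.pi_ne_zero
      field_simp
      ring
    · exact j3.add j4
    · exact j2.add (j3.add j4)
    · exact j1.add (j2.add (j3.add j4))

end

open MeasureTheory Complex

lemma lap_int (f : ℝ → ℂ) (hf : Continuous f) (C c : ℝ) (hb : ∀ t ≥ (0:ℝ), ‖f t‖ ≤ C * Real.exp (c * t))
    (l : ℂ) (hl : c < l.re) : IntegrableOn (fun t : ℝ => f t * cexp (-l * t)) (Set.Ioi 0) := by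
  have h1 : IntegrableOn (fun t : ℝ => Real.exp (-(l.re - c) * t)) (Set.Ioi 0) :=
    integrableOn_exp_mul_Ioi (by linarith) 0
  refine (h1.const_mul C).mono' (Continuous.aestronglyMeasurable (by fun_prop)) ?_
  filter_upwards [ae_restrict_mem measurableSet_Ioi] with t ht
  have ht0 : (0:ℝ) < t := ht
  rw [norm_mul, Complex.norm_exp]
  have e1 : (-l * t).re = -l.re * t := by simp
  rw [e1]
  have e2 : Real.exp (-(l.re - c) * t) = Real.exp (c * t) * Real.exp (-l.re * t) := by
    rw [← Real.exp_add]; ring_nf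
  rw [e2, ← mul_assoc]
  exact mul_le_mul_of_nonneg_right (hb t ht0.le) (Real.exp_pos _).le

lemma lap_conv (f g : ℝ → ℂ) (l : ℂ) (hf : IntegrableOn (fun t : ℝ => f t * cexp (-l * t)) (Set.Ioi 0))
    (hg : IntegrableOn (fun t : ℝ => g t * cexp (-l * t)) (Set.Ioi 0)) :
    IntegrableOn (fun t : ℝ => (∫ τ in (0:ℝ)..t, f (t - τ) * g τ) * cexp (-l * t)) (Set.Ioi 0) ∧
    ∫ t in Set.Ioi (0:ℝ), (∫ τ in (0:ℝ)..t, f (t - τ) * g τ) * cexp (-l * t) =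
      (∫ t in Set.Ioi (0:ℝ), f t * cexp (-l * t)) * ∫ t in Set.Ioi (0:ℝ), g t * cexp (-l * t) := by
  have e : ∀ t : ℝ, ∫ τ in (0:ℝ)..t, (ContinuousLinearMap.mul ℝ ℂ) (g τ * cexp (-l * τ))
      (f (t - τ) * cexp (-l * ((t - τ : ℝ) : ℂ))) =
      (∫ τ in (0:ℝ)..t, f (t - τ) * g τ) * cexp (-l * t) := by
    intro t
    rw [← intervalIntegral.integral_mul_const]
    refine intervalIntegral.integral_congr (fun τ _ => ?_)
    simp only [ContinuousLinearMap.mul_apply']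
    have : cexp (-l * t) = cexp (-l * τ) * cexp (-l * ((t - τ : ℝ) : ℂ)) := by
      rw [← Complex.exp_add]; congr 1; push_cast; ring
    rw [this]; ring
  have h1 := integrable_posConvolution hg hf (ContinuousLinearMap.mul ℝ ℂ)
  have h2 := integral_posConvolution hg hf (ContinuousLinearMap.mul ℝ ℂ)
  simp only [e] at h2
  rw [posConvolution, integrable_indicator_iff measurableSet_Ioi] at h1
  simp only [e] at h1
  refine ⟨h1, ?_⟩
  rw [h2, ContinuousLinearMap.mul_apply', mul_comm]

open FourierTransform in
lemma lap_unique (X : ℝ → ℂ) (hX : Continuous X) (a : ℝ)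
    (hi : ∀ l : ℂ, l.re = a → IntegrableOn (fun t : ℝ => X t * cexp (-l * t)) (Set.Ioi 0))
    (h0 : ∀ l : ℂ, l.re = a → ∫ t in Set.Ioi (0:ℝ), X t * cexp (-l * t) = 0) (t : ℝ) (ht : 0 < t) :
    X t = 0 := by
  set f : ℝ → ℂ := (Set.Ioi (0:ℝ)).indicator (fun t : ℝ => X t * cexp (-(a:ℂ) * t)) with hf
  have hfi : Integrable f := by
    rw [hf, integrable_indicator_iff measurableSet_Ioi]
    exact hi a (by simp)
  have hft : 𝓕 f = fun _ => 0 := by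
    ext w
    rw [Real.fourier_real_eq_integral_exp_smul]
    have := h0 (a + (2 * Real.pi * w : ℝ) * I) (by simp)
    rw [← this, ← integral_indicator measurableSet_Ioi]
    refine integral_congr_ae (Filter.Eventually.of_forall fun v => ?_)
    simp only [hf, Set.indicator]
    split_ifs with h
    · rw [smul_eq_mul, mul_comm, mul_assoc, ← Complex.exp_add]
      congr 2
      push_cast; ring
    · simp
  have hc : ContinuousAt f t := by
    have h1 : ContinuousAt (fun t : ℝ => X t * cexp (-(a:ℂ) * t)) t := by fun_prop
    refine h1.congr ?_
    filter_upwards [Ioi_mem_nhds ht] with s hs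
    rw [hf, Set.indicator_of_mem hs]
  have hinv := hfi.fourierInv_fourier_eq (by rw [hft]; exact integrable_zero _ _ _) hc
  rw [hft] at hinv
  have hz : 𝓕⁻ (fun _ : ℝ => (0:ℂ)) t = 0 := by
    rw [Real.fourierInv_eq']; simp
  rw [hz, hf, Set.indicator_of_mem (show t ∈ Set.Ioi 0 from ht)] at hinv
  exact (mul_eq_zero.mp hinv.symm).resolve_right (Complex.exp_ne_zero _)

lemma volterra_growth (H ρ K : ℝ → ℂ) (hρ : Continuous ρ) (hK : Continuous K)
    (ω B : ℝ) (hω : 0 < ω) (hH : ∀ t ≥ (0:ℝ), ‖H t‖ ≤ B) (hKb : ∀ s ≥ (0:ℝ), ‖K s‖ ≤ ω ^ 2 * s)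
    (hv : ∀ t ≥ (0:ℝ), ρ t = H t - ∫ τ in (0:ℝ)..t, K (t - τ) * ρ τ) :
    ∀ t ≥ (0:ℝ), ‖ρ t‖ ≤ 2 * B * Real.exp (3 * ω * t) := by
  intro T hT
  have hB : 0 ≤ B := (norm_nonneg _).trans (hH 0 le_rfl)
  obtain ⟨t, ht, hmax⟩ := (isCompact_Icc (a := (0:ℝ)) (b := T)).exists_isMaxOn ⟨0, by simp [hT]⟩
    (f := fun t => ‖ρ t‖ * Real.exp (-(3 * ω * t))) (by fun_prop)
  set m := ‖ρ t‖ * Real.exp (-(3 * ω * t)) with hm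
  have hm0 : 0 ≤ m := by positivity
  have hbd : ∀ s ∈ Set.Icc 0 T, ‖ρ s‖ ≤ m * Real.exp (3 * ω * s) := by
    intro s hs
    have h1 : ‖ρ s‖ * Real.exp (-(3 * ω * s)) ≤ m := hmax hs
    rw [Real.exp_neg, ← div_eq_mul_inv, div_le_iff₀ (Real.exp_pos _)] at h1
    exact h1
  suffices hmB : m ≤ 2 * B by
    refine (hbd T ⟨hT, le_rfl⟩).trans ?_
    gcongr
  have ht0 : 0 ≤ t := ht.1
  have hI : ‖∫ τ in (0:ℝ)..t, K (t - τ) * ρ τ‖ ≤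
      ∫ τ in (0:ℝ)..t, m * ω * (Real.exp (ω * t) * Real.exp (2 * ω * τ)) := by
    refine intervalIntegral.norm_integral_le_of_norm_le ht0 ?_ (Continuous.intervalIntegrable (by fun_prop) _ _)
    refine Filter.Eventually.of_forall fun τ hτ => ?_
    have h1 := hKb (t - τ) (by linarith [hτ.2])
    have h2 := hbd τ ⟨hτ.1.le, hτ.2.trans ht.2⟩
    have h3 : ω * (t - τ) ≤ Real.exp (ω * (t - τ)) := by
      have := Real.add_one_le_exp (ω * (t - τ)); linarith
    rw [norm_mul]
    calc ‖K (t - τ)‖ * ‖ρ τ‖ ≤ (ω * Real.exp (ω * (t - τ))) * (m * Real.exp (3 * ω * τ)) := by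
          refine mul_le_mul (h1.trans ?_) h2 (norm_nonneg _) (by positivity)
          rw [pow_two, mul_assoc]; gcongr
      _ = m * ω * (Real.exp (ω * (t - τ)) * Real.exp (3 * ω * τ)) := by ring
      _ = _ := by
          rw [← Real.exp_add, ← Real.exp_add]; ring_nf
  have hI2 : ∫ τ in (0:ℝ)..t, m * ω * (Real.exp (ω * t) * Real.exp (2 * ω * τ)) ≤
      m / 2 * Real.exp (3 * ω * t) := by
    rw [intervalIntegral.integral_const_mul, intervalIntegral.integral_const_mul,
      intervalIntegral.integral_comp_mul_left (fun x => Real.exp x) (by positivity : 2 * ω ≠ 0), integral_exp]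
    have e3 : Real.exp (3 * ω * t) = Real.exp (ω * t) * Real.exp (2 * ω * t) := by
      rw [← Real.exp_add]; ring_nf
    rw [e3, smul_eq_mul, mul_zero, Real.exp_zero]
    have : m * ω * (Real.exp (ω * t) * ((2 * ω)⁻¹ * (Real.exp (2 * ω * t) - 1))) =
      m / 2 * (Real.exp (ω * t) * (Real.exp (2 * ω * t) - 1)) := by field_simp
    rw [this]
    gcongr
    linarith
  have h4 : ‖ρ t‖ ≤ B + m / 2 * Real.exp (3 * ω * t) := by
    rw [hv t ht0]
    exact (norm_sub_le _ _).trans (add_le_add (hH t ht0) (hI.trans hI2))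
  have h5 : m ≤ B + m / 2 := by
    have e : m * Real.exp (3 * ω * t) = ‖ρ t‖ := by
      rw [hm, mul_assoc, ← Real.exp_add]; simp
    have h6 : 1 ≤ Real.exp (3 * ω * t) := Real.one_le_exp (by positivity)
    rw [← e] at h4
    nlinarith
  linarith

lemma volterra_solve (H ρ K G : ℝ → ℂ) (hH : Continuous H) (hρ : Continuous ρ) (hK : Continuous K)
    (hG : Continuous G)
    (ω B C : ℝ) (hω : 0 < ω) (hHb : ∀ t ≥ (0:ℝ), ‖H t‖ ≤ B) (hKb : ∀ s ≥ (0:ℝ), ‖K s‖ ≤ ω ^ 2 * s)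
    (hGb : ∀ t ≥ (0:ℝ), ‖G t‖ ≤ C)
    (hv : ∀ t ≥ (0:ℝ), ρ t = H t - ∫ τ in (0:ℝ)..t, K (t - τ) * ρ τ)
    (hres : ∀ l : ℂ, l.re = 4 * ω → (1 + ∫ t in Set.Ioi (0:ℝ), K t * cexp (-l * t)) *
      (1 + ∫ t in Set.Ioi (0:ℝ), G t * cexp (-l * t)) = 1) :
    ∀ t ≥ (0:ℝ), ρ t - H t = ∫ τ in (0:ℝ)..t, G (t - τ) * H τ := by
  have hgr := volterra_growth H ρ K hρ hK ω B hω hHb hKb hv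
  have iH : ∀ l : ℂ, l.re = 4 * ω → IntegrableOn (fun t : ℝ => H t * cexp (-l * t)) (Set.Ioi 0) :=
    fun l hl => lap_int H hH B 0 (by simpa using hHb) l (by rw [hl]; positivity)
  have iG : ∀ l : ℂ, l.re = 4 * ω → IntegrableOn (fun t : ℝ => G t * cexp (-l * t)) (Set.Ioi 0) :=
    fun l hl => lap_int G hG C 0 (by simpa using hGb) l (by rw [hl]; positivity)
  have iρ : ∀ l : ℂ, l.re = 4 * ω → IntegrableOn (fun t : ℝ => ρ t * cexp (-l * t)) (Set.Ioi 0) :=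
    fun l hl => lap_int ρ hρ (2 * B) (3 * ω) hgr l (by rw [hl]; linarith)
  have iK : ∀ l : ℂ, l.re = 4 * ω → IntegrableOn (fun t : ℝ => K t * cexp (-l * t)) (Set.Ioi 0) :=
    fun l hl => lap_int K hK ω ω (fun s hs => by
      refine (hKb s hs).trans ?_
      have := Real.add_one_le_exp (ω * s)
      rw [pow_two, mul_assoc]; gcongr; linarith) l (by rw [hl]; linarith)
  have hconvc : Continuous fun t : ℝ => ∫ τ in (0:ℝ)..t, G (t - τ) * H τ :=
    intervalIntegral.continuous_parametric_intervalIntegral_of_continuous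
      (f := fun t τ => G (t - τ) * H τ) (by simp only [Function.uncurry_def]; fun_prop) continuous_id
  have key := lap_unique (fun t => ρ t - H t - ∫ τ in (0:ℝ)..t, G (t - τ) * H τ)
    ((hρ.sub hH).sub hconvc) (4 * ω)
    (fun l hl => by
      have := ((iρ l hl).sub (iH l hl)).sub (lap_conv G H l (iG l hl) (iH l hl)).1
      refine this.congr (Filter.Eventually.of_forall fun t => ?_)
      simp only [Pi.sub_apply]; ring)
    (fun l hl => by
      obtain ⟨c1, c2⟩ := lap_conv G H l (iG l hl) (iH l hl)
      obtain ⟨d1, d2⟩ := lap_conv K ρ l (iK l hl) (iρ l hl)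
      have e1 : ∫ t in Set.Ioi (0:ℝ), ρ t * cexp (-l * t) = (∫ t in Set.Ioi (0:ℝ), H t * cexp (-l * t)) -
          (∫ t in Set.Ioi (0:ℝ), K t * cexp (-l * t)) * ∫ t in Set.Ioi (0:ℝ), ρ t * cexp (-l * t) := by
        rw [← d2, ← integral_sub (iH l hl) d1]
        refine setIntegral_congr_fun measurableSet_Ioi (fun t ht => ?_)
        have ht0 : (0:ℝ) < t := ht
        rw [hv t ht0.le]; ring
      have e2 : ∫ t in Set.Ioi (0:ℝ), (ρ t - H t - ∫ τ in (0:ℝ)..t, G (t - τ) * H τ) * cexp (-l * t) =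
          (∫ t in Set.Ioi (0:ℝ), ρ t * cexp (-l * t)) - (∫ t in Set.Ioi (0:ℝ), H t * cexp (-l * t)) -
          ∫ t in Set.Ioi (0:ℝ), (∫ τ in (0:ℝ)..t, G (t - τ) * H τ) * cexp (-l * t) := by
        have i1 : IntegrableOn (fun t : ℝ => ρ t * cexp (-l * t) - H t * cexp (-l * t)) (Set.Ioi 0) :=
          (iρ l hl).sub (iH l hl)
        rw [← integral_sub (iρ l hl) (iH l hl), ← integral_sub i1 c1]
        refine integral_congr_ae (Filter.Eventually.of_forall fun t => ?_)
        simp only; ring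
      rw [e2, c2]
      have hr := hres l hl
      set k := ∫ t in Set.Ioi (0:ℝ), K t * cexp (-l * t)
      set g := ∫ t in Set.Ioi (0:ℝ), G t * cexp (-l * t)
      set r := ∫ t in Set.Ioi (0:ℝ), ρ t * cexp (-l * t)
      set h := ∫ t in Set.Ioi (0:ℝ), H t * cexp (-l * t)
      linear_combination (1 + g) * e1 - r * hr)
  intro t ht
  rcases ht.eq_or_lt with h | h
  · rw [← h, hv 0 le_rfl]; simp
  · exact sub_eq_zero.mp (key t h)

open MeasureTheory Complex

lemma lap_K (β ω κ : ℝ) (hκ : 0 < κ) (l : ℂ) :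
    ∫ t in Set.Ioi (0:ℝ), ((ω:ℂ) ^ 2 * ((t:ℂ) * ((Real.exp (-β * κ ^ 2 * t ^ 2 / 2) : ℝ) : ℂ))) * cexp (-l * t) =
      (ω:ℂ) ^ 2 / κ ^ 2 * mom β 1 (l / κ) := by
  have hk : (κ : ℂ) ≠ 0 := by exact_mod_cast hκ.ne'
  have h := integral_comp_mul_left_Ioi (fun s => momI β 1 (l / κ) s) 0 hκ
  rw [mul_zero] at h
  have e : ∀ t : ℝ, ((ω:ℂ) ^ 2 * ((t:ℂ) * ((Real.exp (-β * κ ^ 2 * t ^ 2 / 2) : ℝ) : ℂ))) * cexp (-l * t) =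
      (ω:ℂ) ^ 2 / κ * momI β 1 (l / κ) (κ * t) := by
    intro t
    rw [momI, Complex.ofReal_exp]
    have : cexp (-(l / κ) * ((κ * t : ℝ) : ℂ) - β * ((κ * t : ℝ) : ℂ) ^ 2 / 2) =
        cexp ((-β * κ ^ 2 * t ^ 2 / 2 : ℝ) : ℂ) * cexp (-l * t) := by
      rw [← Complex.exp_add]; congr 1; push_cast; field_simp; ring
    rw [this]; push_cast; field_simp
  simp_rw [e]
  rw [integral_const_mul, h, mom]
  simp only [Complex.real_smul]
  push_cast
  field_simp

lemma resolvent_id {q : ℂ → ℂ} {β δ Cq L ω κ : ℝ} (Q : QHyp q β δ Cq L) (hω : 0 < ω) (hκ : 0 < κ)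
    (l N : ℂ) (hl : 0 < l.re) (hN : N ≠ 0) (hq : 1 / N = (l / κ) ^ 2 + 3 * β + q (l / κ)) :
    (1 + (ω:ℂ) ^ 2 / κ ^ 2 * N) * (1 + -(ω:ℂ) ^ 2 / DD q β ω κ l) = 1 := by
  have hk : (κ : ℂ) ≠ 0 := by exact_mod_cast hκ.ne'
  have h5 : (l / κ) ^ 2 + 3 * β + q (l / κ) + ((ω ^ 2 / κ ^ 2 : ℝ) : ℂ) = DD q β ω κ l / κ ^ 2 := by
    simp only [DD]; push_cast; field_simp; ring
  have h6 := Q.pen (l / κ) (by rw [Complex.div_ofReal_re]; positivity) (ω ^ 2 / κ ^ 2) (by positivity)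
  rw [h5] at h6
  have hD : DD q β ω κ l ≠ 0 := by intro h; rw [h, zero_div] at h6; exact h6 rfl
  rw [← hq] at h5
  have hD2 : DD q β ω κ l = κ ^ 2 / N + ω ^ 2 := by
    have : DD q β ω κ l = κ ^ 2 * (DD q β ω κ l / κ ^ 2) := by field_simp
    rw [this, ← h5]; push_cast; field_simp
  have h7 : 1 + -(ω:ℂ) ^ 2 / DD q β ω κ l = (κ ^ 2 / N) / DD q β ω κ l := by
    field_simp
    rw [hD2]; field_simp; ring
  rw [h7]
  have h8 : 1 + (ω:ℂ) ^ 2 / κ ^ 2 * N = DD q β ω κ l * N / κ ^ 2 := by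
    rw [hD2]; field_simp
  rw [h8]
  field_simp

lemma two_re (z : ℂ) : ((2 * z.re : ℝ) : ℂ) = z + starRingEnd ℂ z := by
  rw [Complex.add_conj]

lemma lap_exp (J p l : ℂ) (h : p.re < l.re) :
    IntegrableOn (fun t : ℝ => J * cexp (p * t) * cexp (-l * t)) (Set.Ioi 0) ∧
    ∫ t in Set.Ioi (0:ℝ), J * cexp (p * t) * cexp (-l * t) = J / (l - p) := by
  have e : ∀ t : ℝ, J * cexp (p * t) * cexp (-l * t) = J * cexp ((p - l) * t) := by
    intro t; rw [mul_assoc, ← Complex.exp_add]; ring_nf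
  simp_rw [e]
  have hre : (p - l).re < 0 := by simp; linarith
  refine ⟨(integrableOn_exp_mul_complex_Ioi hre 0).const_mul J, ?_⟩
  rw [integral_const_mul, integral_exp_mul_complex_Ioi hre 0]
  simp only [Complex.ofReal_zero, mul_zero, Complex.exp_zero]
  rw [← neg_sub l, neg_div_neg_eq, mul_one_div]

lemma final_step {β δ Cq L ω κ : ℝ} (hβ : 0 < β) (Q : QHyp (qf β) β δ Cq L)
    (hN : ∀ z : ℂ, -(2 * δ) ≤ z.re → mom β 1 z ≠ 0) (hω : 0 < ω) (hκ : 0 < κ)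
    (p J : ℂ) (R : ℝ → ℂ) (hp : p.re < 0) (hR : Continuous R) (CR : ℝ) (hCR : 0 ≤ CR)
    (hRb : ∀ t, ‖R t‖ ≤ CR * Real.exp (-(δ / 2) * κ * t))
    (hRl : ∀ l : ℂ, 0 < l.re → ∫ t in Set.Ioi (0 : ℝ), R t * cexp (-l * t) =
        -(ω : ℂ) ^ 2 / DD (qf β) β ω κ l - J / (l - p) - starRingEnd ℂ J / (l - starRingEnd ℂ p))
    (H ρ : ℝ → ℂ) (hH : Continuous H) (hρ : Continuous ρ) (B : ℝ) (hB : ∀ t ≥ (0:ℝ), ‖H t‖ ≤ B)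
    (hv : ∀ t ≥ (0:ℝ), ρ t = H t - ((ω ^ 2 : ℝ) : ℂ) * ∫ τ in (0:ℝ)..t,
            ((t - τ : ℝ) : ℂ) *
              ((Real.exp (-β * κ ^ 2 * (t - τ) ^ 2 / 2) : ℝ) : ℂ) * ρ τ) (t : ℝ) (ht : 0 ≤ t) :
    ‖ρ t - H t - ∫ τ in (0:ℝ)..t,
              ((2 * (J * Complex.exp (p * (((t : ℝ) : ℂ) - ((τ : ℝ) : ℂ)))).re : ℝ) : ℂ)
                * H τ‖
            ≤ CR * ∫ τ in (0:ℝ)..t, Real.exp (-(δ / 2) * κ * (t - τ)) * ‖H τ‖ := by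
  have hδ := Q.hδ
  set K : ℝ → ℂ := fun t => (ω:ℂ) ^ 2 * ((t:ℂ) * ((Real.exp (-β * κ ^ 2 * t ^ 2 / 2) : ℝ) : ℂ)) with hK
  set S : ℝ → ℂ := fun t => J * cexp (p * t) + starRingEnd ℂ J * cexp (starRingEnd ℂ p * t) with hS
  have hSc : Continuous S := by fun_prop
  have hS2 : ∀ t : ℝ, ((2 * (J * cexp (p * t)).re : ℝ) : ℂ) = S t := by
    intro t
    rw [two_re, hS]
    simp only [map_mul, ← Complex.exp_conj, Complex.conj_ofReal]
  have hSb : ∀ t ≥ (0:ℝ), ‖S t‖ ≤ 2 * ‖J‖ := by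
    intro t ht
    rw [← hS2, Complex.norm_real, Real.norm_eq_abs, abs_mul, abs_two]
    gcongr
    refine (Complex.abs_re_le_norm _).trans ?_
    rw [norm_mul, Complex.norm_exp]
    refine mul_le_of_le_one_right (norm_nonneg _) (Real.exp_le_one_iff.mpr ?_)
    simp
    nlinarith
  have hRb0 : ∀ t ≥ (0:ℝ), ‖R t‖ ≤ CR := by
    intro t ht
    refine (hRb t).trans (mul_le_of_le_one_right hCR (Real.exp_le_one_iff.mpr ?_))
    have : 0 ≤ (δ / 2) * κ * t := by positivity
    linarith
  have hsol := volterra_solve H ρ K (fun t => S t + R t) hH hρ (by fun_prop) (hSc.add hR) ω B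
    (2 * ‖J‖ + CR) hω hB
    (by
      intro s hs
      simp only [hK]
      rw [norm_mul, norm_mul, norm_pow, Complex.norm_real, Complex.norm_real, Complex.norm_real,
        Real.norm_of_nonneg hω.le, Real.norm_of_nonneg hs, Real.norm_of_nonneg (Real.exp_pos _).le]
      gcongr
      refine mul_le_of_le_one_right hs (Real.exp_le_one_iff.mpr ?_)
      have : 0 ≤ β * κ ^ 2 * s ^ 2 / 2 := by positivity
      linarith)
    (fun t ht => (norm_add_le _ _).trans (add_le_add (hSb t ht) (hRb0 t ht)))
    (by
      intro t ht
      rw [hv t ht, ← intervalIntegral.integral_const_mul]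
      congr 1
      refine intervalIntegral.integral_congr (fun τ _ => ?_)
      simp only [hK]; push_cast; ring)
    (by
      intro l hl
      have hl0 : 0 < l.re := by rw [hl]; positivity
      obtain ⟨i1, v1⟩ := lap_exp J p l (by linarith)
      obtain ⟨i2, v2⟩ := lap_exp (starRingEnd ℂ J) (starRingEnd ℂ p) l (by rw [Complex.conj_re]; linarith)
      have i3 : IntegrableOn (fun t : ℝ => R t * cexp (-l * t)) (Set.Ioi 0) :=
        lap_int R hR CR 0 (by simpa using hRb0) l hl0
      have i12 : IntegrableOn (fun t : ℝ => J * cexp (p * t) * cexp (-l * t) +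
        starRingEnd ℂ J * cexp (starRingEnd ℂ p * t) * cexp (-l * t)) (Set.Ioi 0) := i1.add i2
      have e : ∫ t in Set.Ioi (0:ℝ), (S t + R t) * cexp (-l * t) = -(ω : ℂ) ^ 2 / DD (qf β) β ω κ l := by
        have e1 : ∀ t : ℝ, (S t + R t) * cexp (-l * t) = (J * cexp (p * t) * cexp (-l * t) +
          starRingEnd ℂ J * cexp (starRingEnd ℂ p * t) * cexp (-l * t)) + R t * cexp (-l * t) := by
          intro t; simp only [hS]; ring
        simp_rw [e1]
        rw [integral_add i12 i3, integral_add i1 i2, v1, v2, hRl l hl0]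
        ring
      have hm := hN (l / κ) (by
        have : 0 < (l / κ).re := by rw [Complex.div_ofReal_re]; positivity
        linarith)
      rw [e, lap_K β ω κ hκ l]
      exact resolvent_id Q hω hκ l _ hl0 hm (qf_eq β hβ _ hm))
  have h1 := hsol t ht
  have c1 : Continuous fun τ : ℝ => S (t - τ) * H τ := by fun_prop
  have c2 : Continuous fun τ : ℝ => R (t - τ) * H τ := by fun_prop
  have h2 : ∫ τ in (0:ℝ)..t, (S (t - τ) + R (t - τ)) * H τ =
      (∫ τ in (0:ℝ)..t, S (t - τ) * H τ) + ∫ τ in (0:ℝ)..t, R (t - τ) * H τ := by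
    rw [← intervalIntegral.integral_add (c1.intervalIntegrable _ _) (c2.intervalIntegrable _ _)]
    congr 1; ext τ; ring
  have h3 : ∀ τ : ℝ, ((2 * (J * Complex.exp (p * (((t : ℝ) : ℂ) - ((τ : ℝ) : ℂ)))).re : ℝ) : ℂ) = S (t - τ) := by
    intro τ
    rw [← hS2]; push_cast; rfl
  simp_rw [h3]
  rw [h1, h2, add_sub_cancel_left, ← intervalIntegral.integral_const_mul]
  refine intervalIntegral.norm_integral_le_of_norm_le ht ?_ (Continuous.intervalIntegrable (by fun_prop) _ _)
  refine Filter.Eventually.of_forall fun τ _ => ?_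
  rw [norm_mul, ← mul_assoc]
  gcongr
  exact hRb _

theorem volterra_decomposition_fixed_frequency
    (n₀ β ωp w₀ : ℝ) (hn : 0 < n₀) (hβ : 0 < β) (hω : 0 < ωp)
    (hw : w₀ = ωp ^ 2 / n₀) :
    ∃ ν₀ > (0:ℝ), ∃ lam₀ > (0:ℝ), ∃ C > (0:ℝ), ∃ p J : ℝ → ℂ,
      (∀ κ ∈ Set.Ioo (0:ℝ) ν₀,
        (p κ).re < 0 ∧
        ‖p κ - Complex.I * (ωp : ℂ)‖ ≤ C * κ ^ 2 ∧
        ‖J κ - Complex.I * (ωp : ℂ) / 2‖ ≤ C * κ ^ 2) ∧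
      ∀ κ ∈ Set.Ioo (0:ℝ) ν₀, ∀ H ρ : ℝ → ℂ,
        ContinuousOn H (Set.Ici 0) →
        (∃ B : ℝ, ∀ t ≥ (0:ℝ), ‖H t‖ ≤ B) →
        ContinuousOn ρ (Set.Ici 0) →
        (∀ t ≥ (0:ℝ), ρ t = H t -
          ((w₀ * n₀ : ℝ) : ℂ) * ∫ τ in (0:ℝ)..t,
            ((t - τ : ℝ) : ℂ) *
              ((Real.exp (-β * κ ^ 2 * (t - τ) ^ 2 / 2) : ℝ) : ℂ) * ρ τ) →
        ∀ t ≥ (0:ℝ),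
          ‖ρ t - H t - ∫ τ in (0:ℝ)..t,
              ((2 * (J κ * Complex.exp (p κ * (((t : ℝ) : ℂ) - ((τ : ℝ) : ℂ)))).re : ℝ) : ℂ)
                * H τ‖
            ≤ C * κ ^ 3 * ∫ τ in (0:ℝ)..t, Real.exp (-lam₀ * κ * (t - τ)) * ‖H τ‖ := by
  have hwn : w₀ * n₀ = ωp ^ 2 := by rw [hw]; field_simp
  rw [hwn]
  obtain ⟨δ, Cq, L, Q, hN⟩ := exists_QHyp β hβ
  have hδ := Q.hδ
  have hC := Q.hC
  have hL := Q.hL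
  set M := 3 * β + Cq with hM
  have hM0 : 0 < M := by positivity
  set E := 2 * M / ωp + 4 * L / ωp ^ 2 with hE
  have hE0 : 0 < E := by positivity
  set C1 := M / ωp with hC1
  have hC10 : 0 < C1 := by positivity
  set C3 := 16 * Cq * (1 + 4 / δ) / ωp ^ 2 with hC3
  have hC30 : 0 < C3 := by positivity
  set ν := min (ωp / δ) (min (δ * ωp / (4 * M)) (min (ωp / (2 * L)) (min 1 (ωp / E)))) with hν
  have hν0 : 0 < ν := by
    simp only [hν, lt_min_iff]
    refine ⟨by positivity, by positivity, by positivity, by positivity, by positivity⟩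
  have hs : ∀ κ ∈ Set.Ioo (0:ℝ) ν, ∃ (p J : ℂ) (R : ℝ → ℂ), p.re < 0 ∧ ‖p - I * ωp‖ ≤ C1 * κ ^ 2 ∧
      ‖J - I * ωp / 2‖ ≤ E / 2 * κ ^ 2 ∧
      Continuous R ∧
      (∀ t, ‖R t‖ ≤ C3 * κ ^ 3 * Real.exp (-(δ / 2) * κ * t)) ∧
      ∀ l : ℂ, 0 < l.re → ∫ t in Set.Ioi (0 : ℝ), R t * cexp (-l * t) =
        -(ωp : ℂ) ^ 2 / DD (qf β) β ωp κ l - J / (l - p) - starRingEnd ℂ J / (l - starRingEnd ℂ p) := by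
    rintro κ ⟨hκ, hκν⟩
    simp only [hν, lt_min_iff] at hκν
    obtain ⟨a1, a2, a3, a4, a5⟩ := hκν
    rw [lt_div_iff₀ (by positivity)] at a1 a2 a3 a5
    exact spectral Q hω hκ (by linarith) (by linarith) (by linarith) a4.le (by linarith)
  choose! p J R h1 h2 h3 h4 h5 h6 using hs
  refine ⟨ν, hν0, δ / 2, by positivity, C1 + E / 2 + C3, by positivity, p, J, ?_, ?_⟩
  · intro κ hκ
    refine ⟨h1 κ hκ, (h2 κ hκ).trans ?_, (h3 κ hκ).trans ?_⟩
    · gcongr; linarith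
    · gcongr; linarith
  · rintro κ hκ H ρ hH ⟨B, hB⟩ hρ hv t ht
    have hκ0 : 0 < κ := hκ.1
    have hmx : Continuous fun t : ℝ => max t 0 := by fun_prop
    have hH' : Continuous fun t : ℝ => H (max t 0) := hH.comp_continuous hmx (fun t => Set.mem_Ici.mpr (le_max_right t 0))
    have hρ' : Continuous fun t : ℝ => ρ (max t 0) := hρ.comp_continuous hmx (fun t => Set.mem_Ici.mpr (le_max_right t 0))
    have hcong : ∀ {F : Type} [NormedAddCommGroup F] [NormedSpace ℝ F] (f g : ℝ → F) (t : ℝ), 0 ≤ t →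
        (∀ τ, 0 ≤ τ → f τ = g τ) → ∫ τ in (0:ℝ)..t, f τ = ∫ τ in (0:ℝ)..t, g τ := by
      intro F _ _ f g t ht hfg
      refine intervalIntegral.integral_congr (fun τ hτ => ?_)
      rw [Set.uIcc_of_le ht] at hτ
      exact hfg τ hτ.1
    have hfin := final_step hβ Q hN hω hκ0 (p κ) (J κ) (R κ) (h1 κ hκ) (h4 κ hκ) (C3 * κ ^ 3)
      (by positivity) (h5 κ hκ) (h6 κ hκ) (fun t => H (max t 0)) (fun t => ρ (max t 0)) hH' hρ' B
      (fun t _ => hB _ (le_max_right _ _))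
      (by
        intro s hs
        simp only [max_eq_left hs]
        rw [hv s hs]
        congr 2
        refine hcong _ _ s hs (fun τ hτ => ?_)
        rw [max_eq_left hτ]) t ht
    simp only [max_eq_left ht] at hfin
    have g1 : ∫ τ in (0:ℝ)..t,
              ((2 * (J κ * Complex.exp (p κ * (((t : ℝ) : ℂ) - ((τ : ℝ) : ℂ)))).re : ℝ) : ℂ)
                * H τ = ∫ τ in (0:ℝ)..t,
              ((2 * (J κ * Complex.exp (p κ * (((t : ℝ) : ℂ) - ((τ : ℝ) : ℂ)))).re : ℝ) : ℂ)
                * H (max τ 0) := hcong _ _ t ht (fun τ hτ => by rw [max_eq_left hτ])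
    have g2 : ∫ τ in (0:ℝ)..t, Real.exp (-(δ / 2) * κ * (t - τ)) * ‖H τ‖ =
        ∫ τ in (0:ℝ)..t, Real.exp (-(δ / 2) * κ * (t - τ)) * ‖H (max τ 0)‖ :=
      hcong _ _ t ht (fun τ hτ => by rw [max_eq_left hτ])
    rw [g1, g2]
    refine hfin.trans ?_
    have hI : 0 ≤ ∫ τ in (0:ℝ)..t, Real.exp (-(δ / 2) * κ * (t - τ)) * ‖H (max τ 0)‖ :=
      intervalIntegral.integral_nonneg ht (fun τ _ => by positivity)
    gcongr
    linarith
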